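/- arXiv:2105.07679 — 7 statements merged into one kernel-verified Lean document; each statement's English description precedes it below -/
import Mathlib

section
/- For every positive semidefinite matrix ρ : Matrix (a × b × c) (a × b × c) ℂ, the ranks of its bipartite reduced matrices satisfy r(ρ_AB) · r(ρ_AC) ≥ r(ρ_BC). -/
open Matrix
open scoped ComplexOrder

/-- Partial trace over system `C` of a tripartite matrix. -/
noncomputable def traceOutC {a b c : Type*} [Fintype a] [Fintype b] [Fintype c]
    (ρ : Matrix (a × b × c) (a × b × c) ℂ) : Matrix (a × b) (a × b) ℂ :=
  Matrix.of fun p q => ∑ m : c, ρ (p.1, p.2, m) (q.1, q.2, m)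

/-- Partial trace over system `B` of a tripartite matrix. -/
noncomputable def traceOutB {a b c : Type*} [Fintype a] [Fintype b] [Fintype c]
    (ρ : Matrix (a × b × c) (a × b × c) ℂ) : Matrix (a × c) (a × c) ℂ :=
  Matrix.of fun p q => ∑ j : b, ρ (p.1, j, p.2) (q.1, j, q.2)

/-- Partial trace over system `A` of a tripartite matrix. -/
noncomputable def traceOutA {a b c : Type*} [Fintype a] [Fintype b] [Fintype c]
    (ρ : Matrix (a × b × c) (a × b × c) ℂ) : Matrix (b × c) (b × c) ℂ :=
  Matrix.of fun p q => ∑ i : a, ρ (i, p.1, p.2) (i, q.1, q.2)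

universe u1 u2 u3 u4

open Module Filter Topology in
lemma rk_aux_li {B ι : Type*} [AddCommGroup B] [Module ℂ B]
    [FiniteDimensional ℂ B] [Finite ι] (f g : ι → B) (hf : LinearIndependent ℂ f) :
    ∀ᶠ z : ℂ in 𝓝 0, LinearIndependent ℂ (fun i => f i + z • g i) := by
  let e := (Module.finBasis ℂ B).equivFun
  have h1 : LinearIndependent ℂ (fun i => e (f i)) := hf.map' e.toLinearMap e.ker
  have hc : Continuous (fun z : ℂ => (fun i => e (f i) + z • e (g i))) := by fun_prop
  have h2 : Tendsto (fun z : ℂ => (fun i => e (f i) + z • e (g i))) (𝓝 0)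
      (𝓝 (fun i => e (f i))) := by
    have := hc.tendsto 0
    simpa using this
  filter_upwards [h2.eventually h1.eventually] with z hz
  have h3 : LinearIndependent ℂ (e.toLinearMap ∘ (fun i => f i + z • g i)) := by
    have heq : (e.toLinearMap ∘ (fun i => f i + z • g i)) = fun i => e (f i) + z • e (g i) := by
      ext i
      simp
    rw [heq]
    exact hz
  exact LinearIndependent.of_comp _ h3

open Module Filter Topology in
lemma rk_aux_ge {E B : Type*} [AddCommGroup E] [Module ℂ E] [AddCommGroup B] [Module ℂ B]
    [FiniteDimensional ℂ B] [FiniteDimensional ℂ E] (f g : E →ₗ[ℂ] B) :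
    ∀ᶠ z : ℂ in 𝓝 0, finrank ℂ (LinearMap.range f) ≤ finrank ℂ (LinearMap.range (f + z • g)) := by
  let b := Module.finBasis ℂ (LinearMap.range f)
  have hb : ∀ i, ∃ x, f x = b i := fun i => (b i).2
  choose v hv using hb
  have hli : LinearIndependent ℂ (fun i => f (v i)) := by
    simp only [hv]
    exact b.linearIndependent.map' (LinearMap.range f).subtype (Submodule.ker_subtype _)
  filter_upwards [rk_aux_li _ (fun i => g (v i)) hli] with z hz
  have h3 : LinearIndependent ℂ (fun i => (⟨f (v i) + z • g (v i), v i, by simp⟩ :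
      LinearMap.range (f + z • g))) :=
    LinearIndependent.of_comp (LinearMap.range (f + z • g)).subtype hz
  simpa using h3.fintype_card_le_finrank

open Module Filter Topology in
lemma rk_aux_gt {E B : Type*} [AddCommGroup E] [Module ℂ E] [AddCommGroup B] [Module ℂ B]
    [FiniteDimensional ℂ B] [FiniteDimensional ℂ E] (f g : E →ₗ[ℂ] B) (n : E) (hn : f n = 0)
    (hg : g n ∉ LinearMap.range f) :
    ∀ᶠ z : ℂ in 𝓝[≠] 0,
      finrank ℂ (LinearMap.range f) + 1 ≤ finrank ℂ (LinearMap.range (f + z • g)) := by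
  let b := Module.finBasis ℂ (LinearMap.range f)
  have hb : ∀ i, ∃ x, f x = b i := fun i => (b i).2
  choose v hv using hb
  have hli : LinearIndependent ℂ (fun i => f (v i)) := by
    simp only [hv]
    exact b.linearIndependent.map' (LinearMap.range f).subtype (Submodule.ker_subtype _)
  let F : Option (Fin (finrank ℂ (LinearMap.range f))) → B := fun o => o.elim (g n) (fun i => f (v i))
  let G : Option (Fin (finrank ℂ (LinearMap.range f))) → B := fun o => o.elim 0 (fun i => g (v i))
  have hF : LinearIndependent ℂ F := by
    rw [linearIndependent_option]
    refine ⟨hli, fun h => hg ?_⟩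
    refine (Submodule.span_le.2 ?_) h
    rintro _ ⟨i, rfl⟩
    exact ⟨v i, rfl⟩
  filter_upwards [(rk_aux_li F G hF).filter_mono nhdsWithin_le_nhds,
    self_mem_nhdsWithin] with z hz hz0
  have hz0 : z ≠ 0 := hz0
  have hmem : ∀ o, F o + z • G o ∈ LinearMap.range (f + z • g) := by
    rintro (_ | i)
    · exact ⟨z⁻¹ • n, by simp [F, G, hn, smul_smul, hz0]⟩
    · exact ⟨v i, by simp [F, G]⟩
  have h3 : LinearIndependent ℂ (fun o => (⟨F o + z • G o, hmem o⟩ :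
      LinearMap.range (f + z • g))) :=
    LinearIndependent.of_comp (LinearMap.range (f + z • g)).subtype hz
  simpa using h3.fintype_card_le_finrank

open Module in
lemma rk_aux_prod {k M N : Type*} [Field k] [AddCommGroup M] [Module k M] [AddCommGroup N]
    [Module k N] [FiniteDimensional k M] [FiniteDimensional k N]
    (W : Submodule k (M × N)) (W1 : Submodule k M) (W2 : Submodule k N) (h : W ≤ W1.prod W2) :
    finrank k W ≤ finrank k W1 + finrank k W2 := by
  rw [← Module.finrank_prod]
  refine (Submodule.finrank_mono h).trans (le_of_eq ?_)
  let e : (W1.prod W2) ≃ₗ[k] W1 × W2 :=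
    { toFun := fun x => (⟨x.1.1, x.2.1⟩, ⟨x.1.2, x.2.2⟩)
      invFun := fun y => ⟨(y.1.1, y.2.1), ⟨y.1.2, y.2.2⟩⟩
      map_add' := fun _ _ => rfl
      map_smul' := fun _ _ => rfl
      left_inv := fun _ => rfl
      right_inv := fun _ => rfl }
  exact e.finrank_eq

open Module in
lemma rk_aux_split {k B C : Type*} [Field k] [AddCommGroup B] [Module k B] [AddCommGroup C] [Module k C]
    [FiniteDimensional k B] [FiniteDimensional k C] (V : Submodule k (C →ₗ[k] B))
    (U : Submodule k B) (K : Submodule k C) :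
    finrank k V ≤ finrank k (C ⧸ K) * finrank k U
      + finrank k (V.map (LinearMap.llcomp k C B (B ⧸ U) U.mkQ))
      + finrank k (V.map (LinearMap.lcomp k B K.subtype)) := by
  let Φ1 : (C →ₗ[k] B) →ₗ[k] (C →ₗ[k] (B ⧸ U)) := LinearMap.llcomp k C B (B ⧸ U) U.mkQ
  let Φ2 : (C →ₗ[k] B) →ₗ[k] (K →ₗ[k] B) := LinearMap.lcomp k B K.subtype
  let Φ := Φ1.prod Φ2
  have h1 : finrank k V = finrank k (LinearMap.range (Φ.domRestrict V))
      + finrank k (LinearMap.ker (Φ.domRestrict V)) :=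
    (LinearMap.finrank_range_add_finrank_ker _).symm
  have h2 : finrank k (LinearMap.range (Φ.domRestrict V)) ≤
      finrank k (V.map Φ1) + finrank k (V.map Φ2) := by
    refine rk_aux_prod _ _ _ ?_
    rintro _ ⟨v, rfl⟩
    exact ⟨⟨v, v.2, rfl⟩, ⟨v, v.2, rfl⟩⟩
  have h3 : finrank k (LinearMap.ker (Φ.domRestrict V)) ≤ finrank k (C ⧸ K) * finrank k U := by
    rw [← Module.finrank_linearMap k k (C ⧸ K) U]
    have key : ∀ X : LinearMap.ker (Φ.domRestrict V), (∀ x, (X : V).1 x ∈ U) ∧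
        (∀ x ∈ K, (X : V).1 x = 0) := by
      rintro ⟨⟨X, hV⟩, hX⟩
      have hX : Φ X = 0 := hX
      have hX1 : Φ1 X = 0 := congrArg Prod.fst hX
      have hX2 : Φ2 X = 0 := congrArg Prod.snd hX
      refine ⟨fun x => ?_, fun x hx => ?_⟩
      · rw [← Submodule.Quotient.mk_eq_zero]
        exact LinearMap.congr_fun hX1 x
      · exact LinearMap.congr_fun hX2 ⟨x, hx⟩
    let j : LinearMap.ker (Φ.domRestrict V) →ₗ[k] ((C ⧸ K) →ₗ[k] U) :=
      { toFun := fun X => K.liftQ (LinearMap.codRestrict U (X : V).1 (key X).1) (by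
          intro x hx
          exact Subtype.ext ((key X).2 x hx))
        map_add' := by
          intro X Y
          ext x
          rfl
        map_smul' := by
          intro z X
          ext x
          rfl }
    refine LinearMap.finrank_le_finrank_of_injective (f := j) ?_
    intro X Y h
    apply Subtype.ext; apply Subtype.ext
    ext x
    have := LinearMap.congr_fun h (K.mkQ x)
    exact congrArg Subtype.val this
  change _ ≤ _ + finrank k (V.map Φ1) + finrank k (V.map Φ2)
  omega

open Module Filter Topology in
/-- The key bilinear statement, by induction. -/
lemma rk_aux_key {A D : Type*} [AddCommGroup A] [Module ℂ A] (n : ℕ) :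
    ∀ (B : Type u1) (C : Type u2) (E : Type u3) (F : Type u4)
    [AddCommGroup B] [Module ℂ B] [AddCommGroup C] [Module ℂ C]
    [AddCommGroup E] [Module ℂ E] [AddCommGroup F] [Module ℂ F]
    [FiniteDimensional ℂ B] [FiniteDimensional ℂ C]
    [FiniteDimensional ℂ E] [FiniteDimensional ℂ F]
    (P : A → E →ₗ[ℂ] B) (Q : D → C →ₗ[ℂ] E) (S : D → F →ₗ[ℂ] B) (R : A → C →ₗ[ℂ] F),
    (∀ α β (z : ℂ), P (α + z • β) = P α + z • P β) →
    (∀ α β (z : ℂ), R (α + z • β) = R α + z • R β) →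
    (∀ α δ x, P α (Q δ x) = S δ (R α x)) →
    finrank ℂ E + finrank ℂ F ≤ n →
    finrank ℂ (Submodule.span ℂ (Set.range fun p : A × D => P p.1 ∘ₗ Q p.2)) ≤
      finrank ℂ E * finrank ℂ F := by
  induction n with
  | zero =>
    intro B C E F _ _ _ _ _ _ _ _ _ _ _ _ P Q S R hP hR hX hn
    have hE : finrank ℂ E = 0 := by omega
    have : Subsingleton E := finrank_zero_iff.1 hE
    have h0 : Submodule.span ℂ (Set.range fun p : A × D => P p.1 ∘ₗ Q p.2) = ⊥ := by
      rw [Submodule.span_eq_bot]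
      rintro _ ⟨p, rfl⟩
      ext x
      simp [Subsingleton.elim (Q p.2 x) 0]
    rw [h0]; simp
  | succ n ih =>
    intro B C E F _ _ _ _ _ _ _ _ _ _ _ _ P Q S R hP hR hX hn
    -- a point where the total rank is maximal
    obtain ⟨α₀, hα₀⟩ : ∃ α₀ : A, ∀ α, finrank ℂ (LinearMap.range (P α)) +
        finrank ℂ (LinearMap.range (R α)) ≤ finrank ℂ (LinearMap.range (P α₀)) +
        finrank ℂ (LinearMap.range (R α₀)) := by
      have hbd : BddAbove (Set.range fun α => finrank ℂ (LinearMap.range (P α)) +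
          finrank ℂ (LinearMap.range (R α))) := by
        refine ⟨finrank ℂ E + finrank ℂ F, ?_⟩
        rintro _ ⟨α, rfl⟩
        exact add_le_add (LinearMap.finrank_range_le _) (Submodule.finrank_le _)
      obtain ⟨α₀, h⟩ := Nat.sSup_mem (Set.range_nonempty _) hbd
      refine ⟨α₀, fun α => ?_⟩
      have := le_csSup hbd ⟨α, rfl⟩
      rw [← h] at this
      exact this
    have hPN : ∀ α, ∀ v, P α₀ v = 0 → P α v ∈ LinearMap.range (P α₀) := by
      intro α v hv
      by_contra hc
      obtain ⟨z, h1, h2⟩ := ((rk_aux_gt (P α₀) (P α) v hv hc).and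
        ((rk_aux_ge (R α₀) (R α)).filter_mono nhdsWithin_le_nhds)).exists
      have := hα₀ (α₀ + z • α)
      rw [hP, hR] at this
      omega
    have hRN : ∀ α, ∀ v, R α₀ v = 0 → R α v ∈ LinearMap.range (R α₀) := by
      intro α v hv
      by_contra hc
      obtain ⟨z, h1, h2⟩ := ((rk_aux_gt (R α₀) (R α) v hv hc).and
        ((rk_aux_ge (P α₀) (P α)).filter_mono nhdsWithin_le_nhds)).exists
      have := hα₀ (α₀ + z • α)
      rw [hP, hR] at this
      omega
    set p := finrank ℂ (LinearMap.range (P α₀)) with hp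
    set t := finrank ℂ (LinearMap.range (R α₀)) with ht
    have hzero : (∀ α δ x, P α (Q δ x) = 0) →
        finrank ℂ (Submodule.span ℂ (Set.range fun p : A × D => P p.1 ∘ₗ Q p.2)) ≤
        finrank ℂ E * finrank ℂ F := by
      intro h
      have h0 : Submodule.span ℂ (Set.range fun p : A × D => P p.1 ∘ₗ Q p.2) = ⊥ := by
        rw [Submodule.span_eq_bot]
        rintro _ ⟨p, rfl⟩
        ext x
        simp [h]
      rw [h0]; simp
    by_cases hp0 : p = 0
    · apply hzero
      intro α δ x
      have hb : LinearMap.range (P α₀) = ⊥ := Submodule.finrank_eq_zero.1 hp0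
      have h0 : P α₀ = 0 := LinearMap.range_eq_bot.1 hb
      have := hPN α (Q δ x) (by simp [h0])
      simpa [hb] using this
    by_cases ht0 : t = 0
    · apply hzero
      intro α δ x
      have hb : LinearMap.range (R α₀) = ⊥ := Submodule.finrank_eq_zero.1 ht0
      have h0 : R α₀ = 0 := LinearMap.range_eq_bot.1 hb
      have := hRN α x (by simp [h0])
      have h1 : R α x = 0 := by simpa [hb] using this
      rw [hX, h1, map_zero]
    have hNp : p + finrank ℂ (LinearMap.ker (P α₀)) = finrank ℂ E :=
      LinearMap.finrank_range_add_finrank_ker _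
    have hEN : finrank ℂ (E ⧸ LinearMap.ker (P α₀)) = p :=
      (P α₀).quotKerEquivRange.finrank_eq
    have hCK : finrank ℂ (C ⧸ LinearMap.ker (R α₀)) = t :=
      (R α₀).quotKerEquivRange.finrank_eq
    have hFT : finrank ℂ (F ⧸ LinearMap.range (R α₀)) + t = finrank ℂ F :=
      Submodule.finrank_quotient_add_finrank _
    set V := Submodule.span ℂ (Set.range fun p : A × D => P p.1 ∘ₗ Q p.2) with hV
    have hs := rk_aux_split V (LinearMap.range (P α₀)) (LinearMap.ker (R α₀))
    have i1 : finrank ℂ (V.map (LinearMap.llcomp ℂ C B (B ⧸ LinearMap.range (P α₀))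
        (LinearMap.range (P α₀)).mkQ)) ≤ p * finrank ℂ (F ⧸ LinearMap.range (R α₀)) := by
      have hSk : ∀ δ, LinearMap.range (R α₀) ≤ (LinearMap.range (P α₀)).comap (S δ) := by
        rintro δ _ ⟨x, rfl⟩
        exact ⟨Q δ x, hX _ _ _⟩
      have := ih (B ⧸ LinearMap.range (P α₀)) C (E ⧸ LinearMap.ker (P α₀))
        (F ⧸ LinearMap.range (R α₀))
        (fun α => Submodule.mapQ _ _ (P α) (fun v hv => hPN α v hv))
        (fun δ => (Submodule.mkQ _) ∘ₗ Q δ)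
        (fun δ => Submodule.mapQ _ _ (S δ) (hSk δ))
        (fun α => (Submodule.mkQ _) ∘ₗ R α)
        (by intro α β z; ext x; simp [hP]) (by intro α β z; ext x; simp [hR])
        (by intro α δ x; simp [hX]) (by omega)
      rw [hEN] at this
      refine le_trans (le_of_eq ?_) this
      rw [hV, Submodule.map_span, ← Set.range_comp]
      rfl
    have i2 : finrank ℂ (V.map (LinearMap.lcomp ℂ B (LinearMap.ker (R α₀)).subtype)) ≤
        finrank ℂ (LinearMap.ker (P α₀)) * t := by
      have hQk : ∀ δ, ∀ x ∈ LinearMap.ker (R α₀), Q δ x ∈ LinearMap.ker (P α₀) := by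
        intro δ x hx
        rw [LinearMap.mem_ker] at hx ⊢
        rw [hX, hx, map_zero]
      have := ih B (LinearMap.ker (R α₀)) (LinearMap.ker (P α₀)) (LinearMap.range (R α₀))
        (fun α => (P α).domRestrict _)
        (fun δ => (Q δ).restrict (hQk δ))
        (fun δ => (S δ).domRestrict _)
        (fun α => (R α).restrict (fun x hx => hRN α x hx))
        (by intro α β z; ext x; simp [hP]) (by intro α β z; ext x; simp [hR])
        (by intro α δ x; simp [hX]) (by omega)
      refine le_trans (le_of_eq ?_) this
      rw [hV, Submodule.map_span, ← Set.range_comp]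
      rfl
    rw [hCK, ← hp] at hs
    rw [← hNp, ← hFT]
    nlinarith [Nat.zero_le (finrank ℂ (LinearMap.ker (P α₀)) *
      finrank ℂ (F ⧸ LinearMap.range (R α₀)))]

open Module in
/-- Flattening inequality for a four-party tensor. -/
lemma rk_aux_tensor {a b c d : Type*} [Fintype a] [Fintype b] [Fintype c] [Fintype d]
    [DecidableEq a] [DecidableEq b] [DecidableEq c] [DecidableEq d]
    (T : a → b → c → d → ℂ) :
    (Matrix.of fun (p : b × c) (q : a × d) => T q.1 p.1 p.2 q.2).rank ≤
    (Matrix.of fun (p : a × b) (q : c × d) => T p.1 p.2 q.1 q.2).rank *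
    (Matrix.of fun (p : a × c) (q : b × d) => T p.1 q.1 p.2 q.2).rank := by
  set L := (Matrix.of fun (p : b × c) (q : a × d) => T q.1 p.1 p.2 q.2)
  set G := (Matrix.of fun (p : a × b) (q : c × d) => T p.1 p.2 q.1 q.2)
  set H := (Matrix.of fun (p : a × c) (q : b × d) => T p.1 q.1 p.2 q.2)
  rw [← Matrix.rank_transpose H]
  let P0 : (a → ℂ) → (a × b → ℂ) →ₗ[ℂ] (b → ℂ) := fun α =>
    { toFun := fun v j => ∑ i, α i * v (i, j)
      map_add' := by intro v w; ext j; simp [mul_add, Finset.sum_add_distrib]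
      map_smul' := by
        intro z v; ext j; simp only [Pi.smul_apply, smul_eq_mul, RingHom.id_apply, Finset.mul_sum]
        exact Finset.sum_congr rfl fun _ _ => by ring }
  let Q0 : d → (c → ℂ) →ₗ[ℂ] (c × d → ℂ) := fun δ =>
    { toFun := fun x q => if q.2 = δ then x q.1 else 0
      map_add' := by intro v w; ext j; simp; split_ifs <;> simp
      map_smul' := by intro z v; ext j; simp }
  let S0 : d → (b × d → ℂ) →ₗ[ℂ] (b → ℂ) := fun δ =>
    { toFun := fun v j => v (j, δ)
      map_add' := by intro v w; ext j; simp
      map_smul' := by intro z v; ext j; simp }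
  let R0 : (a → ℂ) → (c → ℂ) →ₗ[ℂ] (a × c → ℂ) := fun α =>
    { toFun := fun x q => α q.1 * x q.2
      map_add' := by intro v w; ext j; simp [mul_add]
      map_smul' := by intro z v; ext j; simp; ring }
  let P : (a → ℂ) → LinearMap.range G.mulVecLin →ₗ[ℂ] (b → ℂ) := fun α => (P0 α).domRestrict _
  let Q : d → (c → ℂ) →ₗ[ℂ] LinearMap.range G.mulVecLin := fun δ =>
    G.mulVecLin.rangeRestrict ∘ₗ Q0 δ
  let S : d → LinearMap.range H.transpose.mulVecLin →ₗ[ℂ] (b → ℂ) := fun α => (S0 α).domRestrict _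
  let R : (a → ℂ) → (c → ℂ) →ₗ[ℂ] LinearMap.range H.transpose.mulVecLin := fun δ =>
    H.transpose.mulVecLin.rangeRestrict ∘ₗ R0 δ
  have hPQ : ∀ α δ x j, P α (Q δ x) j = ∑ i, α i * ∑ m, T i j m δ * x m := by
    intro α δ x j
    simp [P, Q, P0, Q0, G, Matrix.mulVec, dotProduct, Fintype.sum_prod_type]
  have hSR : ∀ α δ x j, S δ (R α x) j = ∑ i, α i * ∑ m, T i j m δ * x m := by
    intro α δ x j
    simp [S, R, S0, R0, H, Matrix.vecMul, dotProduct, Fintype.sum_prod_type, Finset.mul_sum]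
    exact Finset.sum_congr rfl fun _ _ => Finset.sum_congr rfl fun _ _ => by ring
  have key := rk_aux_key (A := a → ℂ) (D := d) _ (b → ℂ) (c → ℂ) _ _ P Q S R
    (by
      intro α β z; ext v j
      simp [P, P0, add_mul, Finset.sum_add_distrib, Finset.mul_sum, mul_assoc])
    (by
      intro α β z
      have : R0 (α + z • β) = R0 α + z • R0 β := by
        ext x q
        simp [R0]; ring
      simp only [R, this, LinearMap.comp_add, LinearMap.comp_smul])
    (by intro α δ x; ext j; rw [hPQ, hSR]) le_rfl
  refine le_trans ?_ key
  rw [Matrix.rank_eq_finrank_span_cols]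
  let Ψ : ((c → ℂ) →ₗ[ℂ] (b → ℂ)) →ₗ[ℂ] (b × c → ℂ) :=
    { toFun := fun X p => X (Pi.single p.2 1) p.1
      map_add' := by intro v w; ext j; simp
      map_smul' := by intro z v; ext j; simp }
  refine le_trans (Submodule.finrank_mono (?_ : _ ≤ Submodule.map Ψ (Submodule.span ℂ
    (Set.range fun p : (a → ℂ) × d => P p.1 ∘ₗ Q p.2)))) (Submodule.finrank_map_le _ _)
  rw [Submodule.span_le]
  rintro _ ⟨⟨i, δ⟩, rfl⟩
  refine ⟨P (Pi.single i 1) ∘ₗ Q δ, Submodule.subset_span ⟨(Pi.single i 1, δ), rfl⟩, ?_⟩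
  ext ⟨j, m⟩
  change P (Pi.single i 1) (Q δ (Pi.single m 1)) j = T i j m δ
  rw [hPQ]
  simp [Pi.single_apply]


/-- For any tripartite positive semidefinite matrix `ρ`,
`r(ρ_AB) · r(ρ_AC) ≥ r(ρ_BC)`. -/
theorem rank_traceOutC_mul_rank_traceOutB_ge_rank_traceOutA
    {a b c : Type*} [Fintype a] [Fintype b] [Fintype c]
    [DecidableEq a] [DecidableEq b] [DecidableEq c]
    (ρ : Matrix (a × b × c) (a × b × c) ℂ) (hρ : ρ.PosSemidef) :
    (traceOutC ρ).rank * (traceOutB ρ).rank ≥ (traceOutA ρ).rank := by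
  obtain ⟨n, v, hv⟩ := Matrix.posSemidef_iff_eq_sum_vecMulVec.mp hρ
  let T : a → b → c → Fin n → ℂ := fun i j m d => v d (i, j, m)
  have h := rk_aux_tensor T
  have hA : traceOutA ρ = (Matrix.of fun (p : b × c) (q : a × Fin n) => T q.1 p.1 p.2 q.2) *
      (Matrix.of fun (p : b × c) (q : a × Fin n) => T q.1 p.1 p.2 q.2)ᴴ := by
    ext p q
    simp [traceOutA, hv, Matrix.mul_apply, Matrix.sum_apply, Matrix.vecMulVec_apply,
      Fintype.sum_prod_type, T]
  have hB : traceOutB ρ = (Matrix.of fun (p : a × c) (q : b × Fin n) => T p.1 q.1 p.2 q.2) *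
      (Matrix.of fun (p : a × c) (q : b × Fin n) => T p.1 q.1 p.2 q.2)ᴴ := by
    ext p q
    simp [traceOutB, hv, Matrix.mul_apply, Matrix.sum_apply, Matrix.vecMulVec_apply,
      Fintype.sum_prod_type, T]
  have hC : traceOutC ρ = (Matrix.of fun (p : a × b) (q : c × Fin n) => T p.1 p.2 q.1 q.2) *
      (Matrix.of fun (p : a × b) (q : c × Fin n) => T p.1 p.2 q.1 q.2)ᴴ := by
    ext p q
    simp [traceOutC, hv, Matrix.mul_apply, Matrix.sum_apply, Matrix.vecMulVec_apply,
      Fintype.sum_prod_type, T]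
  rw [hA, hB, hC, Matrix.rank_self_mul_conjTranspose, Matrix.rank_self_mul_conjTranspose,
    Matrix.rank_self_mul_conjTranspose]
  exact h
end

section
/- For every matrix M : Matrix (m₁ × m₂) (n₁ × n₂) ℂ over finite index types, the rank of the partial transpose is bounded by the Schmidt rank times the rank: r(M^{Γ_B}) ≤ Sr(M) · r(M). -/
open Matrix Submodule Module

/-- The `(i,j)`-block of a bipartite matrix. -/
noncomputable def blockOf {m₁ n₁ m₂ n₂ : Type*}
    (M : Matrix (m₁ × m₂) (n₁ × n₂) ℂ) (i : m₁) (j : n₁) : Matrix m₂ n₂ ℂ :=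
  Matrix.of fun k l => M (i, k) (j, l)

/-- The Schmidt rank of a bipartite matrix: the dimension of the span of its blocks. -/
noncomputable def schmidtRank {m₁ n₁ m₂ n₂ : Type*}
    (M : Matrix (m₁ × m₂) (n₁ × n₂) ℂ) : ℕ :=
  Module.finrank ℂ (Submodule.span ℂ
    (Set.range fun ij : m₁ × n₁ => blockOf M ij.1 ij.2))

/-- The partial transpose with respect to the second (B) system. -/
noncomputable def ptB {m₁ n₁ m₂ n₂ : Type*}
    (M : Matrix (m₁ × m₂) (n₁ × n₂) ℂ) : Matrix (m₁ × n₂) (n₁ × m₂) ℂ :=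
  Matrix.of fun p q => M (p.1, q.2) (q.1, p.2)

open Filter Topology in
lemma li_perturb {W : Type*} [AddCommGroup W] [Module ℂ W] [FiniteDimensional ℂ W]
    {ι : Type*} [Finite ι] (v w : ι → W) (hv : LinearIndependent ℂ v) :
    ∀ᶠ t in 𝓝 (0 : ℂ), LinearIndependent ℂ (fun i => v i + t • w i) := by
  let e : W ≃ₗ[ℂ] (Fin (finrank ℂ W) → ℂ) := (Module.finBasis ℂ W).equivFun
  have h1 : LinearIndependent ℂ (fun i => e (v i)) :=
    hv.map' e.toLinearMap (LinearEquiv.ker e)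
  have h2 := h1.eventually
  have h3 : Tendsto (fun t : ℂ => fun i => e (v i) + t • e (w i)) (𝓝 0)
      (𝓝 (fun i => e (v i))) := by
    have hc : Continuous (fun t : ℂ => fun i => e (v i) + t • e (w i)) := by fun_prop
    have := hc.tendsto 0
    simpa using this
  filter_upwards [h3.eventually h2] with t ht
  refine LinearIndependent.of_comp e.toLinearMap ?_
  have heq : (e.toLinearMap ∘ fun i => v i + t • w i) = fun i => e (v i) + t • e (w i) := by
    funext i
    simp
  rw [heq]
  exact ht

open Filter Topology in
lemma rank_perturb {V W : Type*} [AddCommGroup V] [Module ℂ V] [FiniteDimensional ℂ V]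
    [AddCommGroup W] [Module ℂ W] [FiniteDimensional ℂ W] (X Y : V →ₗ[ℂ] W) :
    ∀ᶠ t in 𝓝 (0 : ℂ), finrank ℂ (LinearMap.range X) ≤
      finrank ℂ (LinearMap.range (X + t • Y)) := by
  let b := Module.finBasis ℂ (LinearMap.range X)
  have hb : ∀ i, ∃ u, X u = b i := fun i => (b i).2
  choose u hu using hb
  have hli : LinearIndependent ℂ (fun i => X (u i)) := by
    have := b.linearIndependent.map' (LinearMap.range X).subtype (Submodule.ker_subtype _)
    have heq : (fun i => X (u i)) = (LinearMap.range X).subtype ∘ b := by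
      funext i
      simp [hu]
    rw [heq]
    exact this
  filter_upwards [li_perturb _ (fun i => Y (u i)) hli] with t ht
  have : LinearIndependent ℂ (fun i => (⟨X (u i) + t • Y (u i), ⟨u i, by simp⟩⟩ :
      LinearMap.range (X + t • Y))) := by
    refine LinearIndependent.of_comp (LinearMap.range (X + t • Y)).subtype ?_
    exact ht
  simpa using this.fintype_card_le_finrank

open Filter Topology in
lemma rank_perturb_lt {V W : Type*} [AddCommGroup V] [Module ℂ V] [FiniteDimensional ℂ V]
    [AddCommGroup W] [Module ℂ W] [FiniteDimensional ℂ W] (X Y : V →ₗ[ℂ] W)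
    (z : V) (hz : X z = 0) (hY : Y z ∉ LinearMap.range X) :
    ∀ᶠ t in 𝓝[≠] (0 : ℂ), finrank ℂ (LinearMap.range X) + 1 ≤
      finrank ℂ (LinearMap.range (X + t • Y)) := by
  let b := Module.finBasis ℂ (LinearMap.range X)
  have hb : ∀ i, ∃ u, X u = b i := fun i => (b i).2
  choose u hu using hb
  have hli : LinearIndependent ℂ (fun i => X (u i)) := by
    have := b.linearIndependent.map' (LinearMap.range X).subtype (Submodule.ker_subtype _)
    have heq : (fun i => X (u i)) = (LinearMap.range X).subtype ∘ b := by
      funext i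
      simp [hu]
    rw [heq]
    exact this
  have hli2 : LinearIndependent ℂ (fun o : Option (Fin (finrank ℂ (LinearMap.range X))) =>
      o.elim (Y z) (fun i => X (u i))) := by
    rw [linearIndependent_option]
    refine ⟨hli, fun h => hY ?_⟩
    refine Submodule.span_le.2 ?_ h
    rintro _ ⟨i, rfl⟩
    exact ⟨u i, rfl⟩
  have h0 := li_perturb _ (fun o : Option (Fin (finrank ℂ (LinearMap.range X))) =>
      o.elim 0 (fun i => Y (u i))) hli2
  filter_upwards [h0.filter_mono nhdsWithin_le_nhds, self_mem_nhdsWithin] with t ht ht0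
  have ht0 : t ≠ 0 := ht0
  have hmem : ∀ o : Option (Fin (finrank ℂ (LinearMap.range X))),
      (o.elim (Y z) (fun i => X (u i)) + t • o.elim 0 (fun i => Y (u i)) : W) ∈
        LinearMap.range (X + t • Y) := by
    rintro (_ | i)
    · exact ⟨t⁻¹ • z, by simp [hz, smul_smul, ht0]⟩
    · exact ⟨u i, by simp⟩
  have : LinearIndependent ℂ (fun o => (⟨_, hmem o⟩ : LinearMap.range (X + t • Y))) := by
    refine LinearIndependent.of_comp (LinearMap.range (X + t • Y)).subtype ?_
    exact ht
  simpa using this.fintype_card_le_finrank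

set_option linter.unusedSectionVars false

section aux
variable {A D β γ : Type*} [AddCommGroup A] [Module ℂ A] [FiniteDimensional ℂ A]
  [AddCommGroup D] [Module ℂ D] [FiniteDimensional ℂ D] [Fintype β] [Fintype γ]

/-- Row `(a,b)` of the `AB|CD` flattening. -/
noncomputable def rowV (T : A →ₗ[ℂ] D →ₗ[ℂ] (β → γ → ℂ)) (p : A × β) : γ → (D →ₗ[ℂ] ℂ) :=
  fun c => (LinearMap.proj c ∘ₗ LinearMap.proj (φ := fun _ : β => γ → ℂ) p.2) ∘ₗ T p.1

lemma rowV_apply (T : A →ₗ[ℂ] D →ₗ[ℂ] (β → γ → ℂ)) (p : A × β) (c : γ) (d : D) :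
    rowV T p c d = T p.1 d p.2 c := rfl

/-- Rank of the `AB|CD` flattening. -/
noncomputable def rkT (T : A →ₗ[ℂ] D →ₗ[ℂ] (β → γ → ℂ)) : ℕ :=
  finrank ℂ (Submodule.span ℂ (Set.range (rowV T)))

/-- Contraction of the `C` index with a vector. -/
noncomputable def evC (x : γ → ℂ) : (β → γ → ℂ) →ₗ[ℂ] (β → ℂ) where
  toFun f b := ∑ c, x c * f b c
  map_add' f g := by ext b; simp [mul_add, Finset.sum_add_distrib]
  map_smul' r f := by ext b; simp [Finset.mul_sum, mul_left_comm]

/-- The `C`-slice of `T` along `x`. -/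
noncomputable def sl (T : A →ₗ[ℂ] D →ₗ[ℂ] (β → γ → ℂ)) (x : γ → ℂ) :
    A →ₗ[ℂ] D →ₗ[ℂ] (β → ℂ) := T.compr₂ (evC x)

lemma sl_apply (T : A →ₗ[ℂ] D →ₗ[ℂ] (β → γ → ℂ)) (x : γ → ℂ) (a : A) (d : D) (b : β) :
    sl T x a d b = ∑ c, x c * T a d b c := rfl

lemma sl_flip (T : A →ₗ[ℂ] D →ₗ[ℂ] (β → γ → ℂ)) (x : γ → ℂ) :
    sl T.flip x = (sl T x).flip := rfl

lemma sl_add (T : A →ₗ[ℂ] D →ₗ[ℂ] (β → γ → ℂ)) (x y : γ → ℂ) (t : ℂ) :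
    sl T (x + t • y) = sl T x + t • sl T y := by
  ext a d b
  simp [sl_apply, add_mul, Finset.sum_add_distrib, Finset.mul_sum, mul_assoc]

lemma lemma1 (T : A →ₗ[ℂ] D →ₗ[ℂ] (β → γ → ℂ)) (x : γ → ℂ) :
    finrank ℂ (LinearMap.range (sl T x).flip) +
      rkT (T ∘ₗ (LinearMap.ker (sl T x)).subtype) ≤ rkT T := by
  set S := Submodule.span ℂ (Set.range (rowV T)) with hS
  let con : (γ → (D →ₗ[ℂ] ℂ)) →ₗ[ℂ] (Module.Dual ℂ D) := ∑ c, x c • LinearMap.proj c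
  have hcon : ∀ p d, con (rowV T p) d = sl T x p.1 d p.2 := by
    intro p d
    simp [con, sl_apply, LinearMap.sum_apply, rowV_apply]
  have hrn := LinearMap.finrank_range_add_finrank_ker (con.domRestrict S)
  have h1 : finrank ℂ (LinearMap.range (sl T x).flip) ≤
      finrank ℂ (LinearMap.range (con.domRestrict S)) := by
    have h2 : finrank ℂ (LinearMap.range (con.domRestrict S)) +
        finrank ℂ (LinearMap.range (con.domRestrict S)).dualCoannihilator = finrank ℂ D :=
      Subspace.finrank_add_finrank_dualCoannihilator_eq
        (K := ℂ) (V := D) (LinearMap.range (con.domRestrict S))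
    have h3 := LinearMap.finrank_range_add_finrank_ker (sl T x).flip
    have h4 : (LinearMap.range (con.domRestrict S)).dualCoannihilator ≤
        LinearMap.ker (sl T x).flip := by
      intro d hd
      rw [Submodule.mem_dualCoannihilator] at hd
      rw [LinearMap.mem_ker]
      ext a b
      have := hd (con (rowV T (a, b)))
        ⟨⟨rowV T (a, b), Submodule.subset_span ⟨_, rfl⟩⟩, rfl⟩
      rw [hcon] at this
      simpa using this
    have h5 := Submodule.finrank_mono h4
    omega
  have h2 : rkT (T ∘ₗ (LinearMap.ker (sl T x)).subtype) ≤
      finrank ℂ (LinearMap.ker (con.domRestrict S)) := by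
    rw [← Submodule.finrank_map_subtype_eq S (LinearMap.ker (con.domRestrict S))]
    refine Submodule.finrank_mono (Submodule.span_le.2 ?_)
    rintro _ ⟨⟨a, b⟩, rfl⟩
    refine ⟨⟨rowV T (a, b), Submodule.subset_span ⟨_, rfl⟩⟩, ?_, rfl⟩
    change con (rowV T (a, b)) = 0
    ext d
    rw [hcon]
    have := a.2
    rw [LinearMap.mem_ker] at this
    simp [this]
  have h3 : rkT T = finrank ℂ S := rfl
  omega

lemma rkT_le_of_factor (N : A →ₗ[ℂ] D →ₗ[ℂ] (β → γ → ℂ)) {W : Type*} [AddCommGroup W]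
    [Module ℂ W] [FiniteDimensional ℂ W] (g : γ → D →ₗ[ℂ] W)
    (φ : A → β → Module.Dual ℂ W) (h : ∀ a b c d, N a d b c = φ a b (g c d)) :
    rkT N ≤ finrank ℂ W := by
  let Φ : Module.Dual ℂ W →ₗ[ℂ] (γ → (D →ₗ[ℂ] ℂ)) :=
    LinearMap.pi fun c => LinearMap.lcomp ℂ ℂ (g c)
  have h1 : rkT N ≤ finrank ℂ (LinearMap.range Φ) := by
    refine Submodule.finrank_mono (Submodule.span_le.2 ?_)
    rintro _ ⟨⟨a, b⟩, rfl⟩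
    refine ⟨φ a b, ?_⟩
    ext c d
    rw [rowV_apply, h]
    rfl
  have h2 : finrank ℂ (LinearMap.range Φ) ≤ finrank ℂ (Module.Dual ℂ W) :=
    LinearMap.finrank_range_le _
  rw [Subspace.dual_finrank_eq] at h2
  exact h1.trans h2

lemma lemma2 (T : A →ₗ[ℂ] D →ₗ[ℂ] (β → γ → ℂ)) (x : γ → ℂ)
    (hx : ∀ y, ∀ d ∈ LinearMap.ker (sl T x).flip,
      (sl T y).flip d ∈ LinearMap.range (sl T x).flip) :
    rkT (T.flip ∘ₗ (LinearMap.ker (sl T x).flip).subtype).flip ≤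
      finrank ℂ (LinearMap.range (sl T x).flip) := by
  classical
  refine rkT_le_of_factor (W := LinearMap.range (sl T x).flip) _ (fun c =>
    LinearMap.codRestrict (LinearMap.range (sl T x).flip) ((sl T (Pi.single c 1)).flip ∘ₗ
      (LinearMap.ker (sl T x).flip).subtype) (fun d => hx _ _ d.2))
    (fun a b => ((LinearMap.proj b : (β → ℂ) →ₗ[ℂ] ℂ) ∘ₗ
      (LinearMap.applyₗ a : (A →ₗ[ℂ] (β → ℂ)) →ₗ[ℂ] (β → ℂ))) ∘ₗ
      (LinearMap.range (sl T x).flip).subtype) ?_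
  intro a b c d
  change T a d b c = sl T (Pi.single c 1) a d b
  simp [sl_apply, Pi.single_apply]

open Filter Topology in
lemma exists_max (T : A →ₗ[ℂ] D →ₗ[ℂ] (β → γ → ℂ)) (hT : T ≠ 0) : ∃ x : γ → ℂ,
    0 < finrank ℂ (LinearMap.range (sl T x)) ∧
    0 < finrank ℂ (LinearMap.range (sl T x).flip) ∧
    (∀ y, ∀ d ∈ LinearMap.ker (sl T x).flip,
      (sl T y).flip d ∈ LinearMap.range (sl T x).flip) ∧
    (∀ y, ∀ a ∈ LinearMap.ker (sl T x), sl T y a ∈ LinearMap.range (sl T x)) := by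
  classical
  let f : (γ → ℂ) → ℕ := fun x => finrank ℂ (LinearMap.range (sl T x)) +
    finrank ℂ (LinearMap.range (sl T x).flip)
  have hbdd : BddAbove (Set.range f) := by
    refine ⟨finrank ℂ A + finrank ℂ D, ?_⟩
    rintro _ ⟨x, rfl⟩
    exact add_le_add (LinearMap.finrank_range_le _) (LinearMap.finrank_range_le _)
  obtain ⟨x, hx⟩ := Nat.sSup_mem (Set.range_nonempty f) hbdd
  have hmax : ∀ y, f y ≤ f x := fun y => hx ▸ le_csSup hbdd ⟨y, rfl⟩
  have hne : sl T x ≠ 0 := by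
    intro h0
    apply hT
    have hf0 : f x = 0 := by
      have h1 : LinearMap.range (sl T x) = ⊥ := LinearMap.range_eq_bot.2 h0
      have h2 : LinearMap.range (sl T x).flip = ⊥ := by
        rw [LinearMap.range_eq_bot, h0]
        rfl
      simp only [f]
      rw [h1, h2, finrank_bot, finrank_bot]
    ext a d b c
    have h1 : finrank ℂ (LinearMap.range (sl T (Pi.single c 1))) = 0 := by
      have := hmax (Pi.single c 1)
      simp only [hf0] at this
      simp only [f] at this
      omega
    have h2 : sl T (Pi.single c 1) = 0 := by
      rwa [Submodule.finrank_eq_zero, LinearMap.range_eq_bot] at h1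
    have := congrFun (LinearMap.congr_fun (LinearMap.congr_fun h2 a) d) b
    simpa [sl_apply, Pi.single_apply] using this
  refine ⟨x, ?_, ?_, ?_, ?_⟩
  · rw [Nat.pos_iff_ne_zero, Ne, Submodule.finrank_eq_zero, LinearMap.range_eq_bot]
    exact hne
  · rw [Nat.pos_iff_ne_zero, Ne, Submodule.finrank_eq_zero, LinearMap.range_eq_bot]
    intro h
    apply hne
    ext a d b
    exact congrFun (LinearMap.congr_fun (LinearMap.congr_fun h d) a) b
  · intro y d hd
    by_contra hc
    have e1 := rank_perturb_lt _ _ d hd hc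
    have e2 := (rank_perturb (sl T x) (sl T y)).filter_mono
      (nhdsWithin_le_nhds (s := {0}ᶜ))
    obtain ⟨t, h1, h2⟩ := (e1.and e2).exists
    have h3 := hmax (x + t • y)
    simp only [f] at h3
    rw [sl_add] at h3
    have h4 : (sl T x + t • sl T y).flip = (sl T x).flip + t • (sl T y).flip := rfl
    rw [h4] at h3
    omega
  · intro y a ha
    by_contra hc
    have e1 := rank_perturb_lt _ _ a ha hc
    have e2 := (rank_perturb (sl T x).flip (sl T y).flip).filter_mono
      (nhdsWithin_le_nhds (s := {0}ᶜ))
    obtain ⟨t, h1, h2⟩ := (e1.and e2).exists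
    have h3 := hmax (x + t • y)
    simp only [f] at h3
    rw [sl_add] at h3
    have h4 : (sl T x + t • sl T y).flip = (sl T x).flip + t • (sl T y).flip := rfl
    rw [h4] at h3
    omega

lemma finrank_map₂_le_mul {E : Type*} [AddCommGroup E] [Module ℂ E]
    (T : A →ₗ[ℂ] D →ₗ[ℂ] E) (P : Submodule ℂ A) (Q : Submodule ℂ D)
    [FiniteDimensional ℂ P] [FiniteDimensional ℂ Q] :
    finrank ℂ (Submodule.map₂ T P Q) ≤ finrank ℂ P * finrank ℂ Q := by
  rw [TensorProduct.map₂_eq_range_lift_comp_mapIncl, ← Module.finrank_tensorProduct]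
  exact LinearMap.finrank_range_le _

lemma finrank_split (T : A →ₗ[ℂ] D →ₗ[ℂ] (β → γ → ℂ)) (P : Submodule ℂ A) (Q : Submodule ℂ D) :
    finrank ℂ (Submodule.map₂ T ⊤ ⊤) ≤
      (finrank ℂ A - finrank ℂ P) * (finrank ℂ D - finrank ℂ Q) +
      finrank ℂ (Submodule.map₂ T P ⊤) + finrank ℂ (Submodule.map₂ T ⊤ Q) := by
  obtain ⟨P', hP⟩ := P.exists_isCompl
  obtain ⟨Q', hQ⟩ := Q.exists_isCompl
  have hP1 := Submodule.finrank_add_eq_of_isCompl hP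
  have hQ1 := Submodule.finrank_add_eq_of_isCompl hQ
  have hle : Submodule.map₂ T ⊤ ⊤ ≤
      Submodule.map₂ T P' Q' ⊔ Submodule.map₂ T P ⊤ ⊔ Submodule.map₂ T ⊤ Q := by
    rw [show Submodule.map₂ T ⊤ ⊤ = Submodule.map₂ T (P ⊔ P') ⊤ by rw [hP.sup_eq_top],
      Submodule.map₂_sup_left]
    refine sup_le (le_sup_of_le_left le_sup_right) ?_
    rw [show Submodule.map₂ T P' ⊤ = Submodule.map₂ T P' (Q ⊔ Q') by rw [hQ.sup_eq_top],
      Submodule.map₂_sup_right]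
    exact sup_le (le_sup_of_le_right (Submodule.map₂_le_map₂_left le_top))
      (le_sup_of_le_left le_sup_left)
  have h1 := Submodule.finrank_mono hle
  have h2 := Submodule.finrank_add_le_finrank_add_finrank
    (Submodule.map₂ T P' Q' ⊔ Submodule.map₂ T P ⊤) (Submodule.map₂ T ⊤ Q)
  have h3 := Submodule.finrank_add_le_finrank_add_finrank
    (Submodule.map₂ T P' Q') (Submodule.map₂ T P ⊤)
  have h4 := finrank_map₂_le_mul T P' Q'
  rw [show finrank ℂ A - finrank ℂ P = finrank ℂ P' by omega,
    show finrank ℂ D - finrank ℂ Q = finrank ℂ Q' by omega]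
  omega

end aux

lemma main_aux {β γ : Type*} [Fintype β] [Fintype γ] (n : ℕ) :
    ∀ {A : Type*} {D : Type*} [AddCommGroup A] [Module ℂ A] [FiniteDimensional ℂ A]
    [AddCommGroup D] [Module ℂ D] [FiniteDimensional ℂ D]
    (T : A →ₗ[ℂ] D →ₗ[ℂ] (β → γ → ℂ)), finrank ℂ A + finrank ℂ D = n →
    finrank ℂ (Submodule.map₂ T ⊤ ⊤) ≤ rkT T.flip * rkT T := by
  induction n using Nat.strong_induction_on with
  | _ n ih =>
  intro A D _ _ _ _ _ _ T hn
  by_cases hT : T = 0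
  · have : Submodule.map₂ T ⊤ ⊤ = ⊥ := by
      rw [eq_bot_iff, Submodule.map₂_le]
      simp [hT]
    rw [this, finrank_bot]
    exact Nat.zero_le _
  obtain ⟨x, hα, hδ, hD, hA⟩ := exists_max T hT
  have hsplit := finrank_split T (LinearMap.ker (sl T x)) (LinearMap.ker (sl T x).flip)
  have hkA := LinearMap.finrank_range_add_finrank_ker (sl T x)
  have hkD := LinearMap.finrank_range_add_finrank_ker (sl T x).flip
  have i1 := ih _ (by omega) (T ∘ₗ (LinearMap.ker (sl T x)).subtype) rfl
  have i2 := ih _ (by omega) (T.flip ∘ₗ (LinearMap.ker (sl T x).flip).subtype).flip rfl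
  rw [LinearMap.flip_flip] at i2
  have j1 := lemma1 T x
  have j2 : finrank ℂ (LinearMap.range (sl T x)) +
      rkT (T.flip ∘ₗ (LinearMap.ker (sl T x).flip).subtype) ≤ rkT T.flip := lemma1 T.flip x
  have j3 := lemma2 T x hD
  have j4 : rkT (T ∘ₗ (LinearMap.ker (sl T x)).subtype).flip ≤
      finrank ℂ (LinearMap.range (sl T x)) := lemma2 T.flip x hA
  have e1 : Submodule.map₂ (T ∘ₗ (LinearMap.ker (sl T x)).subtype) ⊤ ⊤ =
      Submodule.map₂ T (LinearMap.ker (sl T x)) ⊤ := by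
    apply le_antisymm
    · rw [Submodule.map₂_le]
      intro a _ d _
      exact Submodule.apply_mem_map₂ T a.2 trivial
    · rw [Submodule.map₂_le]
      intro a ha d _
      exact Submodule.apply_mem_map₂ (T ∘ₗ (LinearMap.ker (sl T x)).subtype)
        (m := ⟨a, ha⟩) (n := d) trivial trivial
  have e2 : Submodule.map₂ (T.flip ∘ₗ (LinearMap.ker (sl T x).flip).subtype).flip ⊤ ⊤ =
      Submodule.map₂ T ⊤ (LinearMap.ker (sl T x).flip) := by
    apply le_antisymm
    · rw [Submodule.map₂_le]
      intro a _ d _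
      exact Submodule.apply_mem_map₂ T trivial d.2
    · rw [Submodule.map₂_le]
      intro a _ d hd
      exact Submodule.apply_mem_map₂ (T.flip ∘ₗ (LinearMap.ker (sl T x).flip).subtype).flip
        (m := a) (n := ⟨d, hd⟩) trivial trivial
  rw [e1] at i1
  rw [e2] at i2
  rw [show finrank ℂ A - finrank ℂ (LinearMap.ker (sl T x)) =
      finrank ℂ (LinearMap.range (sl T x)) by omega,
    show finrank ℂ D - finrank ℂ (LinearMap.ker (sl T x).flip) =
      finrank ℂ (LinearMap.range (sl T x).flip) by omega] at hsplit
  generalize finrank ℂ (LinearMap.range (sl T x)) = α at *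
  generalize finrank ℂ (LinearMap.range (sl T x).flip) = δ at *
  have k1 := Nat.mul_le_mul_right (rkT (T ∘ₗ (LinearMap.ker (sl T x)).subtype)) j4
  have k2 := Nat.mul_le_mul_left
    (rkT (T.flip ∘ₗ (LinearMap.ker (sl T x).flip).subtype)) j3
  generalize rkT (T ∘ₗ (LinearMap.ker (sl T x)).subtype) = rN at *
  generalize rkT (T.flip ∘ₗ (LinearMap.ker (sl T x).flip).subtype) = kN at *
  calc _ ≤ α * δ + α * rN + kN * δ := by omega
    _ ≤ (α + kN) * (δ + rN) := by nlinarith [Nat.zero_le (kN * rN)]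
    _ ≤ _ := Nat.mul_le_mul j2 j1

/-- The tensor of a bipartite matrix. -/
noncomputable def tens {m₁ n₁ m₂ n₂ : Type*} [Fintype m₁] [Fintype n₂]
    (M : Matrix (m₁ × m₂) (n₁ × n₂) ℂ) :
    (m₁ → ℂ) →ₗ[ℂ] (n₂ → ℂ) →ₗ[ℂ] (m₂ → n₁ → ℂ) :=
  LinearMap.mk₂ ℂ (fun a d k j => ∑ i, ∑ l, a i * d l * M (i, k) (j, l))
    (by intros; ext; simp [add_mul, Finset.sum_add_distrib])
    (by intros; ext; simp [Finset.mul_sum, mul_assoc])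
    (by intros; ext; simp [add_mul, mul_add, Finset.sum_add_distrib])
    (by intros; ext; simp [Finset.mul_sum, mul_assoc, mul_left_comm])

lemma tens_apply {m₁ n₁ m₂ n₂ : Type*} [Fintype m₁] [Fintype n₂]
    (M : Matrix (m₁ × m₂) (n₁ × n₂) ℂ) (a : m₁ → ℂ) (d : n₂ → ℂ) (k : m₂) (j : n₁) :
    tens M a d k j = ∑ i, ∑ l, a i * d l * M (i, k) (j, l) := rfl

/-- `r(M^{Γ_B}) ≤ Sr(M) · r(M)`. -/
theorem rank_ptB_le_schmidtRank_mul_rank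
    {m₁ n₁ m₂ n₂ : Type*} [Fintype m₁] [Fintype n₁] [Fintype m₂] [Fintype n₂]
    [DecidableEq m₁] [DecidableEq n₁] [DecidableEq m₂] [DecidableEq n₂]
    (M : Matrix (m₁ × m₂) (n₁ × n₂) ℂ) :
    (ptB M).rank ≤ schmidtRank M * M.rank := by
  have h0 := main_aux _ (tens M) rfl
  have h1 : (ptB M).rank ≤ finrank ℂ (Submodule.map₂ (tens M) ⊤ ⊤) := by
    rw [Matrix.rank_eq_finrank_span_row]
    let Ψ : (m₂ → n₁ → ℂ) →ₗ[ℂ] (n₁ × m₂ → ℂ) :=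
      { toFun := fun f q => f q.2 q.1
        map_add' := fun _ _ => rfl
        map_smul' := fun _ _ => rfl }
    refine le_trans (Submodule.finrank_mono (Submodule.span_le.2 ?_))
      (Submodule.finrank_map_le Ψ (Submodule.map₂ (tens M) ⊤ ⊤))
    rintro _ ⟨⟨i, l⟩, rfl⟩
    refine ⟨tens M (Pi.single i 1) (Pi.single l 1),
      Submodule.apply_mem_map₂ _ trivial trivial, ?_⟩
    ext ⟨j, k⟩
    simp [Ψ, tens_apply, Pi.single_apply, ptB, Matrix.row]
  have h2 : rkT (tens M) ≤ M.rank := by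
    rw [Matrix.rank_eq_finrank_span_row]
    let Ψ : (n₁ × n₂ → ℂ) →ₗ[ℂ] (n₁ → ((n₂ → ℂ) →ₗ[ℂ] ℂ)) :=
      LinearMap.pi fun j => ∑ l, (LinearMap.proj (j, l)).smulRight
        (LinearMap.proj l : (n₂ → ℂ) →ₗ[ℂ] ℂ)
    refine le_trans (Submodule.finrank_mono (Submodule.span_le.2 ?_))
      (Submodule.finrank_map_le Ψ (Submodule.span ℂ (Set.range M.row)))
    rintro _ ⟨⟨a, k⟩, rfl⟩
    refine ⟨∑ i, a i • M.row (i, k), Submodule.sum_mem _ fun i _ =>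
      Submodule.smul_mem _ _ (Submodule.subset_span ⟨_, rfl⟩), ?_⟩
    ext j l
    simp [Ψ, rowV_apply, tens_apply, Pi.single_apply, Matrix.row, LinearMap.sum_apply]
  have h3 : rkT (tens M).flip ≤ schmidtRank M := by
    set W := Submodule.span ℂ (Set.range fun ij : m₁ × n₁ => blockOf M ij.1 ij.2) with hW
    let bl : m₁ → n₁ → W := fun i j => ⟨blockOf M i j, Submodule.subset_span ⟨(i, j), rfl⟩⟩
    let Φ : Module.Dual ℂ W →ₗ[ℂ] (n₁ → ((m₁ → ℂ) →ₗ[ℂ] ℂ)) :=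
      LinearMap.pi fun j => ∑ i, (LinearMap.applyₗ (bl i j)).smulRight
        (LinearMap.proj i : (m₁ → ℂ) →ₗ[ℂ] ℂ)
    calc rkT (tens M).flip ≤ finrank ℂ (LinearMap.range Φ) := by
          refine Submodule.finrank_mono (Submodule.span_le.2 ?_)
          rintro _ ⟨⟨d, k⟩, rfl⟩
          refine ⟨(∑ l, d l • Matrix.entryLinearMap ℂ ℂ k l) ∘ₗ W.subtype, ?_⟩
          ext j i
          simp [Φ, bl, rowV_apply, tens_apply, Pi.single_apply, blockOf, LinearMap.sum_apply]
      _ ≤ finrank ℂ (Module.Dual ℂ W) := LinearMap.finrank_range_le _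
      _ = _ := Subspace.dual_finrank_eq
  exact h1.trans (h0.trans (Nat.mul_le_mul h3 h2))
end

section
/- For every matrix M : Matrix (m₁ × m₂) (n₁ × n₂) ℂ over finite index types, the rank of the partial transpose with respect to the first system is bounded by the Schmidt rank times the rank: r(M^{Γ_A}) ≤ Sr(M) · r(M). -/
open Matrix Submodule Module

/-- The partial transpose with respect to the first (A) system. -/
noncomputable def ptA {m₁ n₁ m₂ n₂ : Type*}
    (M : Matrix (m₁ × m₂) (n₁ × n₂) ℂ) : Matrix (n₁ × m₂) (m₁ × n₂) ℂ :=
  Matrix.of fun p q => M (q.1, p.2) (p.1, q.2)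

universe u v

/-- Generic lower semicontinuity of rank along a line. -/
lemma finite_rank_drop {V F : Type*} [AddCommGroup V] [Module ℂ V] [AddCommGroup F] [Module ℂ F]
    [FiniteDimensional ℂ V] [FiniteDimensional ℂ F] (f g : V →ₗ[ℂ] F) :
    {e : ℂ | finrank ℂ (LinearMap.range (f + e • g)) < finrank ℂ (LinearMap.range f)}.Finite := by
  obtain ⟨s, hs⟩ := f.rangeRestrict.exists_rightInverse_of_surjective f.range_rangeRestrict
  obtain ⟨p, hp⟩ := (LinearMap.range f).subtype.exists_leftInverse_of_injective
    (Submodule.ker_subtype _)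
  let G : Module.End ℂ (LinearMap.range f) := p ∘ₗ g ∘ₗ s
  have hfin := Module.End.finite_hasEigenvalue G
  refine (hfin.preimage (f := fun e : ℂ => -e⁻¹) ?_).subset ?_
  · intro a _ b _ h
    simpa using h
  · intro e he
    simp only [Set.mem_ofPred_eq] at he
    simp only [Set.mem_preimage]
    by_contra hne
    have hfs : ∀ x, p (f (s x)) = x := by
      intro x
      have h1 := LinearMap.congr_fun hs x
      have h2 : f (s x) = (LinearMap.range f).subtype x := by
        have := congrArg Subtype.val h1
        simpa using this
      rw [h2]
      exact LinearMap.congr_fun hp x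
    have hinj : Function.Injective ((f + e • g) ∘ₗ s) := by
      rw [injective_iff_map_eq_zero]
      intro x hx
      by_contra hx0
      have h3 : x + e • G x = 0 := by
        have := congrArg p hx
        simpa [hfs, G] using this
      have he0 : e ≠ 0 := by
        rintro rfl
        simp at h3
        exact hx0 h3
      apply hne
      apply Module.End.hasEigenvalue_of_hasEigenvector (x := x)
      refine ⟨?_, hx0⟩
      rw [Module.End.mem_eigenspace_iff]
      have h4 : e • G x = -x := by rw [eq_neg_iff_add_eq_zero, add_comm]; exact h3
      have : G x = e⁻¹ • (e • G x) := by rw [smul_smul, inv_mul_cancel₀ he0, one_smul]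
      rw [this, h4]; simp
    have h5 := LinearMap.finrank_range_of_inj hinj
    have h6 : finrank ℂ (LinearMap.range ((f + e • g) ∘ₗ s)) ≤
        finrank ℂ (LinearMap.range (f + e • g)) :=
      Submodule.finrank_mono (LinearMap.range_comp_le_range _ _)
    omega

/-- First-order condition at a point of maximal rank. -/
lemma mem_range_of_max {V F : Type*} [AddCommGroup V] [Module ℂ V] [AddCommGroup F] [Module ℂ F]
    [FiniteDimensional ℂ V] [FiniteDimensional ℂ F] (f g : V →ₗ[ℂ] F)
    (hmax : ∀ e : ℂ, finrank ℂ (LinearMap.range (f + e • g)) ≤ finrank ℂ (LinearMap.range f))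
    (x : V) (hx : f x = 0) : g x ∈ LinearMap.range f := by
  by_contra hgx
  let f' : V × ℂ →ₗ[ℂ] F := f.coprod (LinearMap.toSpanSingleton ℂ F (g x))
  let g' : V × ℂ →ₗ[ℂ] F := g ∘ₗ LinearMap.fst ℂ V ℂ
  have hlt : finrank ℂ (LinearMap.range f) < finrank ℂ (LinearMap.range f') := by
    apply Submodule.finrank_lt_finrank_of_lt
    refine lt_of_le_of_ne ?_ ?_
    · rintro _ ⟨v, rfl⟩
      exact ⟨(v, 0), by simp [f']⟩
    · intro h
      apply hgx
      rw [h]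
      exact ⟨(0, 1), by simp [f']⟩
  have hfin := (finite_rank_drop f' g').union (Set.finite_singleton (0 : ℂ))
  obtain ⟨e, he⟩ := hfin.infinite_compl.nonempty
  simp only [Set.mem_compl_iff, Set.mem_union, Set.mem_ofPred_eq, Set.mem_singleton_iff, not_or,
    not_lt] at he
  obtain ⟨he1, he0⟩ := he
  have hle : LinearMap.range (f' + e • g') ≤ LinearMap.range (f + e • g) := by
    rintro _ ⟨⟨v, c⟩, rfl⟩
    refine ⟨v + (c * e⁻¹) • x, ?_⟩
    have hc : e * (c * e⁻¹) = c := by field_simp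
    simp [f', g', hx, smul_smul, hc]
    abel
  have := Submodule.finrank_mono hle
  have := hmax e
  omega

section flat
variable {A B C E : Type*} [AddCommGroup A] [Module ℂ A] [AddCommGroup B] [Module ℂ B]
  [AddCommGroup C] [Module ℂ C] [AddCommGroup E] [Module ℂ E]

/-- Span of the values of a bilinear map. -/
def bspan (s : A →ₗ[ℂ] B →ₗ[ℂ] E) : Submodule ℂ E :=
  Submodule.span ℂ (Set.range fun p : A × B => s p.1 p.2)

/-- Swap the second and third argument. -/
def sw (t : A →ₗ[ℂ] B →ₗ[ℂ] C →ₗ[ℂ] E) : A →ₗ[ℂ] C →ₗ[ℂ] B →ₗ[ℂ] E :=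
  LinearMap.lflip.toLinearMap ∘ₗ t

/-- Bring the first argument to the last place. -/
def rot (t : A →ₗ[ℂ] B →ₗ[ℂ] C →ₗ[ℂ] E) : B →ₗ[ℂ] C →ₗ[ℂ] A →ₗ[ℂ] E := sw t.flip

/-- Restrict the third argument. -/
def resC (t : A →ₗ[ℂ] B →ₗ[ℂ] C →ₗ[ℂ] E) (q : Submodule ℂ C) : A →ₗ[ℂ] B →ₗ[ℂ] q →ₗ[ℂ] E :=
  t.compr₂ (LinearMap.lcomp ℂ E q.subtype)

/-- Restrict the second argument. -/
def resB (t : A →ₗ[ℂ] B →ₗ[ℂ] C →ₗ[ℂ] E) (p : Submodule ℂ B) : A →ₗ[ℂ] p →ₗ[ℂ] C →ₗ[ℂ] E :=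
  t.compl₂ p.subtype

@[simp] lemma sw_apply (t : A →ₗ[ℂ] B →ₗ[ℂ] C →ₗ[ℂ] E) (a b c) : sw t a c b = t a b c := rfl
@[simp] lemma rot_apply (t : A →ₗ[ℂ] B →ₗ[ℂ] C →ₗ[ℂ] E) (a b c) : rot t b c a = t a b c := rfl
@[simp] lemma resC_apply (t : A →ₗ[ℂ] B →ₗ[ℂ] C →ₗ[ℂ] E) (q : Submodule ℂ C) (a b) (c : q) :
    resC t q a b c = t a b c := rfl
@[simp] lemma resB_apply (t : A →ₗ[ℂ] B →ₗ[ℂ] C →ₗ[ℂ] E) (p : Submodule ℂ B) (a) (b : p) (c) :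
    resB t p a b c = t a b c := rfl

variable [FiniteDimensional ℂ A] [FiniteDimensional ℂ B] [FiniteDimensional ℂ C]
  [FiniteDimensional ℂ E]

lemma rk1_ge (t : A →ₗ[ℂ] B →ₗ[ℂ] C →ₗ[ℂ] E) (q : Submodule ℂ C) (α : A)
    (h : ∀ b, ∀ c ∈ q, t α b c = 0) :
    finrank ℂ (LinearMap.range (t α)) + finrank ℂ (bspan (resC t q)) ≤ finrank ℂ (bspan t) := by
  let ρ : (C →ₗ[ℂ] E) →ₗ[ℂ] (q →ₗ[ℂ] E) := LinearMap.lcomp ℂ E q.subtype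
  have h1 : bspan (resC t q) = (bspan t).map ρ := by
    unfold bspan
    rw [Submodule.map_span, ← Set.range_comp]
    rfl
  have h2 : LinearMap.range (t α) ≤ bspan t := by
    rintro _ ⟨b, rfl⟩
    exact Submodule.subset_span ⟨(α, b), rfl⟩
  have h3 := LinearMap.finrank_range_add_finrank_ker (ρ.domRestrict (bspan t))
  rw [LinearMap.range_domRestrict, ← h1] at h3
  have h4 : finrank ℂ (LinearMap.range (t α)) ≤
      finrank ℂ (LinearMap.ker (ρ.domRestrict (bspan t))) := by
    rw [← (Submodule.comapSubtypeEquivOfLe h2).finrank_eq]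
    apply Submodule.finrank_mono
    rintro ⟨x, hx⟩ hx'
    obtain ⟨b, hb⟩ := hx'
    simp only [Submodule.subtype_apply] at hb
    subst hb
    rw [LinearMap.mem_ker]
    ext ⟨c, hc⟩
    exact h b c hc
  omega

lemma bspan_le_three (s : B →ₗ[ℂ] C →ₗ[ℂ] E) (B0 : Submodule ℂ B) (C0 : Submodule ℂ C) (u k : ℕ)
    (hu : u + finrank ℂ B0 = finrank ℂ B) (hk : k + finrank ℂ C0 = finrank ℂ C) :
    finrank ℂ (bspan s) ≤ u * k + finrank ℂ (bspan (s.compl₂ C0.subtype)) +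
      finrank ℂ (bspan (s ∘ₗ B0.subtype)) := by
  obtain ⟨B1, hB⟩ := B0.exists_isCompl
  obtain ⟨C1, hC⟩ := C0.exists_isCompl
  have e1 := Submodule.finrank_add_eq_of_isCompl hB
  have e2 := Submodule.finrank_add_eq_of_isCompl hC
  let L : TensorProduct ℂ B1 C1 →ₗ[ℂ] E := TensorProduct.lift (s.compl₁₂ B1.subtype C1.subtype)
  have hL : finrank ℂ (LinearMap.range L) ≤ u * k := by
    refine (LinearMap.finrank_range_le L).trans ?_
    rw [Module.finrank_tensorProduct]
    apply Nat.mul_le_mul <;> omega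
  have hle : bspan s ≤ LinearMap.range L ⊔ bspan (s.compl₂ C0.subtype) ⊔
      bspan (s ∘ₗ B0.subtype) := by
    unfold bspan
    rw [Submodule.span_le]
    rintro _ ⟨⟨b, c⟩, rfl⟩
    obtain ⟨b0, hb0, b1, hb1, rfl⟩ := Submodule.mem_sup.1
      (hB.sup_eq_top ▸ Submodule.mem_top : b ∈ B0 ⊔ B1)
    obtain ⟨c0, hc0, c1, hc1, rfl⟩ := Submodule.mem_sup.1
      (hC.sup_eq_top ▸ Submodule.mem_top : c ∈ C0 ⊔ C1)
    have : s (b0 + b1) (c0 + c1) = s b1 c1 + s b1 c0 + s b0 (c0 + c1) := by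
      simp; abel
    simp only [SetLike.mem_coe, this]
    refine Submodule.add_mem_sup (Submodule.add_mem_sup ?_ ?_) ?_
    · exact ⟨TensorProduct.tmul ℂ ⟨b1, hb1⟩ ⟨c1, hc1⟩, by simp [L]⟩
    · exact Submodule.subset_span ⟨(b1, ⟨c0, hc0⟩), rfl⟩
    · exact Submodule.subset_span ⟨(⟨b0, hb0⟩, c0 + c1), rfl⟩
  have h1 := Submodule.finrank_mono hle
  have h2 := Submodule.finrank_add_le_finrank_add_finrank
    (LinearMap.range L ⊔ bspan (s.compl₂ C0.subtype)) (bspan (s ∘ₗ B0.subtype))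
  have h3 := Submodule.finrank_add_le_finrank_add_finrank
    (LinearMap.range L) (bspan (s.compl₂ C0.subtype))
  omega

lemma exists_max_s2 {F G : Type*} [AddCommGroup F] [Module ℂ F] [FiniteDimensional ℂ F]
    [AddCommGroup G] [Module ℂ G] [FiniteDimensional ℂ G]
    (f : A →ₗ[ℂ] B →ₗ[ℂ] F) (g : A →ₗ[ℂ] C →ₗ[ℂ] G) :
    ∃ α, (∀ a, finrank ℂ (LinearMap.range (f a)) ≤ finrank ℂ (LinearMap.range (f α))) ∧
      (∀ a, finrank ℂ (LinearMap.range (g a)) ≤ finrank ℂ (LinearMap.range (g α))) := by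
  have key : ∀ φ : A → ℕ, (∃ N, ∀ a, φ a ≤ N) → ∃ α, ∀ a, φ a ≤ φ α := by
    rintro φ ⟨N, hN⟩
    have hb : BddAbove (Set.range φ) := ⟨N, by rintro _ ⟨a, rfl⟩; exact hN a⟩
    obtain ⟨α, hα⟩ := Nat.sSup_mem (Set.range_nonempty φ) hb
    exact ⟨α, fun a => hα ▸ le_csSup hb ⟨a, rfl⟩⟩
  obtain ⟨α₁, h1⟩ := key (fun a => finrank ℂ (LinearMap.range (f a)))
    ⟨_, fun a => LinearMap.finrank_range_le _⟩
  obtain ⟨α₂, h2⟩ := key (fun a => finrank ℂ (LinearMap.range (g a)))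
    ⟨_, fun a => LinearMap.finrank_range_le _⟩
  have hf1 := finite_rank_drop (f α₁) (f α₂)
  have hf2 := (finite_rank_drop (g α₂) (g α₁)).preimage (f := fun e : ℂ => e⁻¹)
    (inv_injective.injOn)
  obtain ⟨e, he⟩ := ((hf1.union hf2).union (Set.finite_singleton (0 : ℂ))).infinite_compl.nonempty
  simp only [Set.mem_compl_iff, Set.mem_union, Set.mem_ofPred_eq, Set.mem_singleton_iff, not_or,
    not_lt, Set.mem_preimage] at he
  obtain ⟨⟨he1, he2⟩, he0⟩ := he
  refine ⟨α₁ + e • α₂, fun a => (h1 a).trans ?_, fun a => (h2 a).trans ?_⟩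
  · rw [map_add, map_smul]; exact he1
  · have : g (α₁ + e • α₂) = e • (g α₂ + e⁻¹ • g α₁) := by
      simp [smul_smul, he0, add_comm]
    rw [this, LinearMap.range_smul _ _ he0]
    exact he2

end flat

theorem flat_main {A : Type*} {E : Type*} [AddCommGroup A] [Module ℂ A] [AddCommGroup E]
    [Module ℂ E] [FiniteDimensional ℂ A] [FiniteDimensional ℂ E] (N : ℕ) :
    ∀ {B : Type u} {C : Type v} [AddCommGroup B] [Module ℂ B] [AddCommGroup C] [Module ℂ C]
      [FiniteDimensional ℂ B] [FiniteDimensional ℂ C] (t : A →ₗ[ℂ] B →ₗ[ℂ] C →ₗ[ℂ] E),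
      finrank ℂ B + finrank ℂ C ≤ N →
      finrank ℂ (bspan (rot t)) ≤ finrank ℂ (bspan (sw t)) * finrank ℂ (bspan t) := by
  induction N with
  | zero =>
    intro B C _ _ _ _ _ _ t hN
    have hB : finrank ℂ B = 0 := by omega
    have := Module.finrank_zero_iff.1 hB
    have h0 : bspan (rot t) = ⊥ := by
      unfold bspan
      rw [Submodule.span_eq_bot]
      rintro _ ⟨⟨b, c⟩, rfl⟩
      rw [Subsingleton.elim b 0]; simp
    rw [h0]; simp
  | succ N ih =>
    intro B C _ _ _ _ _ _ t hN
    obtain ⟨α, hα1, hα2⟩ := exists_max_s2 t (sw t)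
    set u := finrank ℂ (LinearMap.range (t α)) with hu
    set k := finrank ℂ (LinearMap.range (sw t α)) with hk
    let B0 := LinearMap.ker (t α)
    let C0 := LinearMap.ker (sw t α)
    have hu' : u + finrank ℂ B0 = finrank ℂ B := LinearMap.finrank_range_add_finrank_ker _
    have hk' : k + finrank ℂ C0 = finrank ℂ C := LinearMap.finrank_range_add_finrank_ker _
    by_cases ht : ∀ a, t a = 0
    · have h0 : bspan (rot t) = ⊥ := by
        unfold bspan
        rw [Submodule.span_eq_bot]
        rintro _ ⟨⟨b, c⟩, rfl⟩
        ext a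
        simp [ht]
      rw [h0]; simp
    have hupos : 0 < u := by
      push Not at ht
      obtain ⟨a, ha⟩ := ht
      refine lt_of_lt_of_le ?_ (hα1 a)
      rw [Nat.pos_iff_ne_zero]
      intro h
      rw [Submodule.finrank_eq_zero, LinearMap.range_eq_bot] at h
      exact ha h
    have hkpos : 0 < k := by
      rw [Nat.pos_iff_ne_zero]
      intro h
      rw [hk, Submodule.finrank_eq_zero, LinearMap.range_eq_bot] at h
      have : t α = 0 := by
        ext b c
        rw [← sw_apply, h]; rfl
      have hu0 : u = 0 := by rw [hu, this, LinearMap.range_zero, finrank_bot]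
      omega
    have m1 : ∀ a, ∀ b ∈ B0, t a b ∈ LinearMap.range (t α) := fun a b hb =>
      mem_range_of_max (t α) (t a) (fun e => by rw [← map_smul, ← map_add]; exact hα1 (α + e • a)) b hb
    have m2 : ∀ a, ∀ c ∈ C0, sw t a c ∈ LinearMap.range (sw t α) := fun a b hb =>
      mem_range_of_max (sw t α) (sw t a) (fun e => by rw [← map_smul, ← map_add]; exact hα2 (α + e • a)) b hb
    have g1 := rk1_ge t C0 α (fun b c hc => by
      rw [← sw_apply, LinearMap.mem_ker.1 hc]; rfl)
    have g2 := rk1_ge (sw t) B0 α (fun c b hb => by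
      rw [sw_apply, LinearMap.mem_ker.1 hb]; rfl)
    have i1 := ih (resC t C0) (by omega)
    have i2 := ih (resB t B0) (by omega)
    have b1 : finrank ℂ (bspan (sw (resC t C0))) ≤ k := by
      apply Submodule.finrank_mono
      unfold bspan
      rw [Submodule.span_le]
      rintro _ ⟨⟨a, c⟩, rfl⟩
      exact m2 a c c.2
    have b2 : finrank ℂ (bspan (resB t B0)) ≤ u := by
      apply Submodule.finrank_mono
      unfold bspan
      rw [Submodule.span_le]
      rintro _ ⟨⟨a, b⟩, rfl⟩
      exact m1 a b b.2
    have g3 := bspan_le_three (rot t) B0 C0 u k hu' hk'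
    have r1 : (rot t).compl₂ C0.subtype = rot (resC t C0) := rfl
    have r2 : (rot t) ∘ₗ B0.subtype = rot (resB t B0) := rfl
    have r3 : resC (sw t) B0 = sw (resB t B0) := rfl
    rw [r1, r2] at g3
    rw [r3] at g2
    rw [← hu] at g1
    rw [← hk] at g2
    generalize finrank ℂ (bspan (rot (resC t C0))) = x1 at *
    generalize finrank ℂ (bspan (rot (resB t B0))) = x2 at *
    generalize finrank ℂ (bspan (sw (resB t B0))) = y at *
    generalize finrank ℂ (bspan (resC t C0)) = z at *
    have j1 := i1.trans (Nat.mul_le_mul_right z b1)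
    have j2 := i2.trans (Nat.mul_le_mul_left y b2)
    calc _ ≤ u * k + x1 + x2 := g3
      _ ≤ u * k + k * z + y * u := by omega
      _ ≤ (k + y) * (u + z) := by nlinarith [Nat.zero_le (y * z)]
      _ ≤ _ := Nat.mul_le_mul g2 g1

/-- The span of values of a bilinear map is spanned by the values on standard basis vectors. -/
lemma bspan_pi {m n E : Type*} [Fintype m] [Fintype n] [DecidableEq m] [DecidableEq n]
    [AddCommGroup E] [Module ℂ E] (s : (m → ℂ) →ₗ[ℂ] (n → ℂ) →ₗ[ℂ] E) :
    bspan s = Submodule.span ℂ (Set.range fun p : m × n =>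
      s (Pi.basisFun ℂ m p.1) (Pi.basisFun ℂ n p.2)) := by
  apply le_antisymm
  · unfold bspan
    rw [Submodule.span_le]
    rintro _ ⟨⟨a, b⟩, rfl⟩
    have : s a b = ∑ i, ∑ j, a i • b j • s (Pi.basisFun ℂ m i) (Pi.basisFun ℂ n j) := by
      conv_lhs => rw [← (Pi.basisFun ℂ m).sum_repr a, ← (Pi.basisFun ℂ n).sum_repr b]
      simp only [map_sum, map_smul, LinearMap.sum_apply, LinearMap.smul_apply, Finset.smul_sum,
        Pi.basisFun_repr]
      rw [Finset.sum_comm]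
      refine Finset.sum_congr rfl fun i _ => Finset.sum_congr rfl fun j _ => ?_
      rw [smul_comm]
    simp only [this, SetLike.mem_coe]
    exact Submodule.sum_mem _ fun i _ => Submodule.sum_mem _ fun j _ =>
      Submodule.smul_mem _ _ (Submodule.smul_mem _ _ (Submodule.subset_span ⟨(i, j), rfl⟩))
  · apply Submodule.span_mono
    rintro _ ⟨p, rfl⟩
    exact ⟨(_, _), rfl⟩

lemma finrank_span_equiv {ι V W : Type*} [AddCommGroup V] [Module ℂ V] [AddCommGroup W]
    [Module ℂ W] (e : V ≃ₗ[ℂ] W) (v : ι → V) (w : ι → W) (h : ∀ i, e (v i) = w i) :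
    finrank ℂ (Submodule.span ℂ (Set.range w)) = finrank ℂ (Submodule.span ℂ (Set.range v)) := by
  have : w = e ∘ v := by funext i; exact (h i).symm
  rw [this, Set.range_comp, ← LinearEquiv.coe_coe, ← Submodule.map_span]
  exact LinearEquiv.finrank_map_eq e _

/-- `r(M^{Γ_A}) ≤ Sr(M) · r(M)`. -/
theorem rank_ptA_le_schmidtRank_mul_rank
    {m₁ n₁ m₂ n₂ : Type*} [Fintype m₁] [Fintype n₁] [Fintype m₂] [Fintype n₂]
    [DecidableEq m₁] [DecidableEq n₁] [DecidableEq m₂] [DecidableEq n₂]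
    (M : Matrix (m₁ × m₂) (n₁ × n₂) ℂ) :
    (ptA M).rank ≤ schmidtRank M * M.rank := by
  let t : (m₁ → ℂ) →ₗ[ℂ] (m₂ → ℂ) →ₗ[ℂ] (n₁ → ℂ) →ₗ[ℂ] (n₂ → ℂ) :=
    (Pi.basisFun ℂ m₁).constr ℂ fun i => (Pi.basisFun ℂ m₂).constr ℂ fun k =>
      (Pi.basisFun ℂ n₁).constr ℂ fun j => fun l => M (i, k) (j, l)
  have ht : ∀ i k j, t (Pi.basisFun ℂ m₁ i) (Pi.basisFun ℂ m₂ k) (Pi.basisFun ℂ n₁ j) =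
      fun l => M (i, k) (j, l) := by
    intro i k j
    simp only [t, Module.Basis.constr_basis]
  have key := flat_main _ t le_rfl
  have e1 : finrank ℂ (bspan t) = M.rank := by
    rw [bspan_pi, Matrix.rank_eq_finrank_span_row]
    refine finrank_span_equiv ((LinearEquiv.curry ℂ ℂ n₁ n₂).trans
      ((Pi.basisFun ℂ n₁).constr ℂ)) _ _ ?_
    rintro ⟨i, k⟩
    refine (Pi.basisFun ℂ n₁).ext fun j => ?_
    rw [ht, LinearEquiv.trans_apply, Module.Basis.constr_basis]
    rfl
  have e2 : finrank ℂ (bspan (sw t)) = schmidtRank M := by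
    rw [bspan_pi, schmidtRank]
    refine finrank_span_equiv ((Pi.basisFun ℂ m₂).constr ℂ : (m₂ → n₂ → ℂ) ≃ₗ[ℂ] _) _ _ ?_
    rintro ⟨i, j⟩
    refine (Pi.basisFun ℂ m₂).ext fun k => ?_
    rw [sw_apply, ht]
    exact Module.Basis.constr_basis _ _ _ _
  have e3 : finrank ℂ (bspan (rot t)) = (ptA M).rank := by
    rw [bspan_pi, Matrix.rank_eq_finrank_span_row]
    have : Set.range (ptA M).row = Set.range fun p : m₂ × n₁ => (ptA M).row p.swap := by
      ext x
      constructor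
      · rintro ⟨p, rfl⟩; exact ⟨p.swap, by simp⟩
      · rintro ⟨p, rfl⟩; exact ⟨p.swap, rfl⟩
    rw [this]
    refine finrank_span_equiv ((LinearEquiv.curry ℂ ℂ m₁ n₂).trans
      ((Pi.basisFun ℂ m₁).constr ℂ)) _ _ ?_
    rintro ⟨k, j⟩
    refine (Pi.basisFun ℂ m₁).ext fun i => ?_
    rw [rot_apply, ht, LinearEquiv.trans_apply, Module.Basis.constr_basis]
    rfl
  rw [e1, e2, e3] at key
  exact key
end

section
/- Let K : ℕ and let R : Fin K → Matrix m₁ n₁ ℂ and S : Fin K → Matrix m₂ n₂ ℂ be linearly independent families of matrices over finite index types. Then r(∑ i, R i ⊗ₖ S i) ≤ K · r(∑ i, R i ⊗ₖ (S i)ᵀ), where ⊗ₖ is the Kronecker product. -/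
open Matrix
open scoped Kronecker

namespace RankAux

open Module Submodule

/-- Rank-nullity in the form used below. -/
lemma finrank_map_add_le {X Y : Type*} [AddCommGroup X] [Module ℂ X] [FiniteDimensional ℂ X]
    [AddCommGroup Y] [Module ℂ Y] (L : X →ₗ[ℂ] Y) (W Z : Submodule ℂ X)
    (hZW : Z ≤ W) (hZ : Z ≤ LinearMap.ker L) :
    finrank ℂ (W.map L) + finrank ℂ Z ≤ finrank ℂ W := by
  have h := LinearMap.finrank_range_add_finrank_ker (L.domRestrict W)
  rw [LinearMap.range_domRestrict] at h
  have h2 : finrank ℂ Z ≤ finrank ℂ (LinearMap.ker (L.domRestrict W)) := by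
    rw [← (Submodule.comapSubtypeEquivOfLe hZW).finrank_eq]
    apply Submodule.finrank_mono
    intro w hw
    have := hZ hw
    simpa using this
  omega

/-- If `f` has maximal rank in the pencil `f + t g`, then `g (ker f) ⊆ range f`. -/
lemma pencil {C V : Type*} [AddCommGroup C] [Module ℂ C]
    [AddCommGroup V] [Module ℂ V] [FiniteDimensional ℂ V] (f g : C →ₗ[ℂ] V)
    (h : ∀ t : ℂ, finrank ℂ (LinearMap.range (f + t • g)) ≤ finrank ℂ (LinearMap.range f))
    (y : C) (hy : f y = 0) : g y ∈ LinearMap.range f := by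
  by_contra hg
  let b := finBasis ℂ (LinearMap.range f)
  have he : ∀ i, ∃ e, f e = b i := fun i => (b i).2
  choose e he using he
  let v : ℂ → Option (Fin (finrank ℂ (LinearMap.range f))) → V := fun t o =>
    o.casesOn' (g y) (fun i => f (e i) + t • g (e i))
  have h0 : LinearIndependent ℂ (v 0) := by
    have hb : LinearIndependent ℂ (fun i => ((b i : LinearMap.range f) : V)) :=
      b.linearIndependent.map' (LinearMap.range f).subtype (Submodule.ker_subtype _)
    have hv : v 0 = fun o => o.casesOn' (g y) (fun i => ((b i : LinearMap.range f) : V)) := by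
      funext o
      cases o <;> simp [v, he]
    rw [hv]
    refine linearIndependent_option'.2 ⟨hb, fun hmem => hg ?_⟩
    refine (Submodule.span_le.2 ?_) hmem
    rintro _ ⟨i, rfl⟩
    exact (b i).2
  let E : V ≃ₗ[ℂ] (Fin (finrank ℂ V) → ℂ) := (finBasis ℂ V).equivFun
  have hopen := isOpen_setOfPred_linearIndependent (𝕜 := ℂ)
    (E := Fin (finrank ℂ V) → ℂ) (ι := Option (Fin (finrank ℂ (LinearMap.range f))))
  have hcont : Continuous (fun t : ℂ => fun o => E (v t o)) := by
    rw [continuous_pi_iff]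
    intro o
    cases o with
    | none =>
      change Continuous (fun _ : ℂ => E (g y))
      fun_prop
    | some i =>
      simp only [v, Option.casesOn'_some, map_add, map_smul]
      fun_prop
  have hE : ∀ t, LinearIndependent ℂ (fun o => E (v t o)) ↔ LinearIndependent ℂ (v t) := fun t =>
    LinearMap.linearIndependent_iff (E : V →ₗ[ℂ] (Fin (finrank ℂ V) → ℂ)) E.ker
  have hev : ∀ᶠ t in nhds (0 : ℂ), LinearIndependent ℂ (fun o => E (v t o)) :=
    (hopen.preimage hcont).mem_nhds ((hE 0).2 h0)
  have hev' : ∀ᶠ t in nhdsWithin (0 : ℂ) {0}ᶜ, LinearIndependent ℂ (v t) ∧ t ≠ 0 := by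
    refine ((hev.filter_mono nhdsWithin_le_nhds).mono fun t ht => (hE t).1 ht).and ?_
    exact self_mem_nhdsWithin
  obtain ⟨t, ht, ht0⟩ := hev'.exists
  have hc := finrank_span_eq_card ht
  have hle : span ℂ (Set.range (v t)) ≤ LinearMap.range (f + t • g) := by
    refine Submodule.span_le.2 ?_
    rintro _ ⟨o, rfl⟩
    cases o with
    | none => exact ⟨t⁻¹ • y, by simp [v, hy, smul_smul, ht0]⟩
    | some i => exact ⟨e i, by simp [v]⟩
  have h1 := Submodule.finrank_mono hle
  have h2 := h t
  simp only [Fintype.card_option, Fintype.card_fin] at hc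
  omega

variable {A B C D : Type*} [AddCommGroup A] [Module ℂ A] [FiniteDimensional ℂ A]
  [AddCommGroup B] [Module ℂ B] [FiniteDimensional ℂ B]
  [AddCommGroup C] [Module ℂ C] [FiniteDimensional ℂ C]
  [AddCommGroup D] [Module ℂ D] [FiniteDimensional ℂ D]

/-- The first flattening. -/
def W1 (T : D →ₗ[ℂ] C →ₗ[ℂ] B →ₗ[ℂ] A) : Submodule ℂ (B →ₗ[ℂ] A) :=
  span ℂ (Set.range fun p : D × C => T p.1 p.2)

/-- The second flattening. -/
def W2 (T : D →ₗ[ℂ] C →ₗ[ℂ] B →ₗ[ℂ] A) : Submodule ℂ (D →ₗ[ℂ] A) :=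
  span ℂ (Set.range fun p : C × B => (T.flip p.1).flip p.2)

/-- The third flattening. -/
def W3 (T : D →ₗ[ℂ] C →ₗ[ℂ] B →ₗ[ℂ] A) : Submodule ℂ (C →ₗ[ℂ] A) :=
  span ℂ (Set.range fun p : D × B => (T p.1).flip p.2)

theorem main (n : ℕ) : ∀ T : D →ₗ[ℂ] C →ₗ[ℂ] B →ₗ[ℂ] A,
    finrank ℂ (W1 T) + finrank ℂ (W2 T) ≤ n →
    finrank ℂ (W3 T) ≤ finrank ℂ (W1 T) * finrank ℂ (W2 T) := by
  induction n using Nat.strong_induction_on with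
  | _ n ih =>
  intro T hn
  by_cases hT : T = 0
  · subst hT
    have : W3 (0 : D →ₗ[ℂ] C →ₗ[ℂ] B →ₗ[ℂ] A) = ⊥ := by
      refine Submodule.span_eq_bot.2 ?_
      rintro _ ⟨p, rfl⟩
      ext
      simp
    rw [this]
    simp
  -- choose `x` with `T x` of maximal rank
  obtain ⟨x, hx⟩ : ∃ x, ∀ x', finrank ℂ (LinearMap.range (T x')) ≤
      finrank ℂ (LinearMap.range (T x)) := by
    have hfin : (Set.range fun x => finrank ℂ (LinearMap.range (T x))).Finite := by
      refine (Set.finite_Iic (finrank ℂ (B →ₗ[ℂ] A))).subset ?_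
      rintro _ ⟨x, rfl⟩
      exact Submodule.finrank_le _
    obtain ⟨_, ⟨x, rfl⟩, hx⟩ := Set.exists_max_image _ id hfin ⟨_, ⟨0, rfl⟩⟩
    exact ⟨x, fun x' => hx _ ⟨x', rfl⟩⟩
  have hTx : T x ≠ 0 := by
    intro h0
    apply hT
    ext1 x'
    have := hx x'
    rw [h0, LinearMap.range_zero, finrank_bot, Nat.le_zero] at this
    have := Submodule.finrank_eq_zero.1 this
    simpa using LinearMap.range_eq_bot.1 this
  let F := T x
  let Vx := LinearMap.range F
  let U : Submodule ℂ A := (W2 T).map (LinearMap.applyₗ x)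
  have hU : ∀ y b, T x y b ∈ U := fun y b =>
    ⟨(T.flip y).flip b, subset_span ⟨(y, b), rfl⟩, by simp⟩
  have hVx : 0 < finrank ℂ Vx := by
    rw [Nat.pos_iff_ne_zero]
    intro h
    exact hTx (LinearMap.range_eq_bot.1 (Submodule.finrank_eq_zero.1 h))
  have hUpos : 0 < finrank ℂ U := by
    rw [Nat.pos_iff_ne_zero]
    intro h
    have h := Submodule.finrank_eq_zero.1 h
    apply hTx
    ext y b
    have := hU y b
    rw [h] at this
    simpa using this
  obtain ⟨s, hs⟩ := F.rangeRestrict.exists_rightInverse_of_surjective F.range_rangeRestrict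
  obtain ⟨π, hπ⟩ := U.subtype.exists_leftInverse_of_injective U.ker_subtype
  let Q : C →ₗ[ℂ] C := LinearMap.id - s ∘ₗ F.rangeRestrict
  let P : A →ₗ[ℂ] A := LinearMap.id - U.subtype ∘ₗ π
  have hP : ∀ u ∈ U, P u = 0 := by
    intro u hu
    have := LinearMap.congr_fun hπ ⟨u, hu⟩
    simp only [LinearMap.comp_apply, Submodule.subtype_apply, LinearMap.id_apply] at this
    simp [P, this]
  have hQ : ∀ y, T x (Q y) = 0 := by
    intro y
    have := LinearMap.congr_fun hs (F.rangeRestrict y)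
    simp only [LinearMap.comp_apply, LinearMap.id_apply] at this
    have := congrArg Subtype.val this
    change T x (s (F.rangeRestrict y)) = T x y at this
    simp only [Q, LinearMap.sub_apply, LinearMap.id_apply, LinearMap.comp_apply, map_sub]
    exact sub_eq_zero.2 this.symm
  have hgen : ∀ x' y, T x' (Q y) ∈ Vx := by
    intro x' y
    refine pencil (T x) (T x') (fun t => ?_) (Q y) (hQ y)
    have := hx (x + t • x')
    rwa [map_add, map_smul] at this
  have hVU : ∀ v ∈ Vx, ∀ b, v b ∈ U := by
    rintro _ ⟨y, rfl⟩ b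
    exact hU y b
  let TP := T.compr₂ (LinearMap.compRight ℂ P : (B →ₗ[ℂ] A) →ₗ[ℂ] (B →ₗ[ℂ] A))
  let TN := T.compl₂ Q
  -- ranks of `TP`
  have a1 : finrank ℂ (W1 TP) + finrank ℂ Vx ≤ finrank ℂ (W1 T) := by
    have : W1 TP = (W1 T).map (LinearMap.compRight ℂ P : (B →ₗ[ℂ] A) →ₗ[ℂ] (B →ₗ[ℂ] A)) := by
      rw [W1, W1, Submodule.map_span, ← Set.range_comp]
      rfl
    rw [this]
    refine finrank_map_add_le _ _ _ ?_ ?_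
    · rintro _ ⟨y, rfl⟩
      exact subset_span ⟨(x, y), rfl⟩
    · intro v hv
      rw [LinearMap.mem_ker]
      ext b
      exact hP _ (hVU v hv b)
  have a2 : finrank ℂ (W2 TP) ≤ finrank ℂ (W2 T) := by
    have : W2 TP = (W2 T).map (LinearMap.compRight ℂ P : (D →ₗ[ℂ] A) →ₗ[ℂ] (D →ₗ[ℂ] A)) := by
      rw [W2, W2, Submodule.map_span, ← Set.range_comp]
      rfl
    rw [this]
    exact Submodule.finrank_map_le _ _
  -- ranks of `TN`
  have b1 : finrank ℂ (W1 TN) ≤ finrank ℂ Vx := by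
    apply Submodule.finrank_mono
    refine Submodule.span_le.2 ?_
    rintro _ ⟨p, rfl⟩
    exact hgen p.1 p.2
  have b2 : finrank ℂ U + finrank ℂ (W2 TN) ≤ finrank ℂ (W2 T) := by
    refine finrank_map_add_le _ _ _ ?_ ?_
    · refine Submodule.span_le.2 ?_
      rintro _ ⟨p, rfl⟩
      exact subset_span ⟨(Q p.1, p.2), rfl⟩
    · refine Submodule.span_le.2 ?_
      rintro _ ⟨p, rfl⟩
      change T x (Q p.1) p.2 = 0
      rw [hQ]
      rfl
  -- decomposition of the third flattening
  let L : (Vx →ₗ[ℂ] U) →ₗ[ℂ] (C →ₗ[ℂ] A) :=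
    (LinearMap.compRight ℂ U.subtype) ∘ₗ (LinearMap.lcomp ℂ U F.rangeRestrict)
  have c1 : W3 T ≤ (W3 TP ⊔ W3 TN) ⊔ LinearMap.range L := by
    refine Submodule.span_le.2 ?_
    rintro _ ⟨⟨x', b⟩, rfl⟩
    have e : (T x').flip b = ((TP x').flip b + (TN x').flip b)
        + L (π ∘ₗ (T x').flip b ∘ₗ s) := by
      ext y
      have h1 : P (T x' (Q y) b) = 0 := hP _ (hVU _ (hgen x' y) b)
      have h2 : ∀ a, (π a : A) = a - P a := by intro a; simp [P]
      have h3 : s (F.rangeRestrict y) = y - Q y := by simp [Q]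
      change T x' y b = (P (T x' y b) + T x' (Q y) b)
        + (π (T x' (s (F.rangeRestrict y)) b) : A)
      rw [h2, h3]
      simp only [map_sub, LinearMap.sub_apply, h1]
      abel
    change (T x').flip b ∈ _
    rw [e]
    refine Submodule.add_mem_sup (Submodule.add_mem_sup ?_ ?_) ⟨_, rfl⟩
    · exact subset_span ⟨(x', b), rfl⟩
    · exact subset_span ⟨(x', b), rfl⟩
  have c2 : finrank ℂ (LinearMap.range L) ≤ finrank ℂ Vx * finrank ℂ U := by
    have := LinearMap.finrank_range_le L
    rwa [Module.finrank_linearMap] at this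
  have c3 := Submodule.finrank_mono c1
  have c4 := Submodule.finrank_add_le_finrank_add_finrank (W3 TP ⊔ W3 TN) (LinearMap.range L)
  have c5 := Submodule.finrank_add_le_finrank_add_finrank (W3 TP) (W3 TN)
  have i1 := ih _ (by omega) TP le_rfl
  have i2 := ih _ (by omega) TN le_rfl
  have j1 : finrank ℂ (W1 TP) * finrank ℂ (W2 TP) ≤ finrank ℂ (W1 TP) * finrank ℂ (W2 T) :=
    Nat.mul_le_mul_left _ a2
  have j2 : finrank ℂ (W1 TN) * finrank ℂ (W2 TN) ≤ finrank ℂ Vx * finrank ℂ (W2 TN) :=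
    Nat.mul_le_mul_right _ b1
  have j3 : finrank ℂ Vx * (finrank ℂ U + finrank ℂ (W2 TN)) ≤ finrank ℂ Vx * finrank ℂ (W2 T) :=
    Nat.mul_le_mul_left _ b2
  have j4 : (finrank ℂ (W1 TP) + finrank ℂ Vx) * finrank ℂ (W2 T)
      ≤ finrank ℂ (W1 T) * finrank ℂ (W2 T) := Nat.mul_le_mul_right _ a1
  rw [mul_add] at j3
  rw [add_mul] at j4
  omega

end RankAux

/-- If `R : Fin K → Matrix m₁ n₁ ℂ` and `S : Fin K → Matrix m₂ n₂ ℂ` are linearly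
independent families, then `r(∑ i, R i ⊗ₖ S i) ≤ K · r(∑ i, R i ⊗ₖ (S i)ᵀ)`. -/
theorem rank_sum_kronecker_le_card_mul_rank_sum_kronecker_transpose
    {m₁ n₁ m₂ n₂ : Type*} [Fintype m₁] [Fintype n₁] [Fintype m₂] [Fintype n₂]
    [DecidableEq m₁] [DecidableEq n₁] [DecidableEq m₂] [DecidableEq n₂]
    (K : ℕ) (R : Fin K → Matrix m₁ n₁ ℂ) (S : Fin K → Matrix m₂ n₂ ℂ)
    (hR : LinearIndependent ℂ R) (hS : LinearIndependent ℂ S) :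
    (∑ i, R i ⊗ₖ S i).rank ≤ K * (∑ i, R i ⊗ₖ (S i)ᵀ).rank := by
  let T : (n₂ → ℂ) →ₗ[ℂ] (m₂ → ℂ) →ₗ[ℂ] (n₁ → ℂ) →ₗ[ℂ] (m₁ → ℂ) :=
    ∑ a, (LinearMap.mk₂ ℂ (fun x y => (y ⬝ᵥ (S a *ᵥ x)) • (R a).mulVecLin)
      (by intros; simp [mulVec_add, add_smul])
      (by intros; simp [mulVec_smul, smul_smul])
      (by intros; simp [add_smul])
      (by intros; simp [smul_smul]))
  have hTa : ∀ x y b, T x y b = ∑ a, (y ⬝ᵥ (S a *ᵥ x)) • (R a *ᵥ b) := by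
    intro x y b
    simp [T, LinearMap.sum_apply]
  have hT1 : ∀ x y, T x y = ∑ a, (y ⬝ᵥ (S a *ᵥ x)) • (R a).mulVecLin := by
    intro x y
    simp [T, LinearMap.sum_apply]
  have h1 : Module.finrank ℂ (RankAux.W1 T) ≤ K := by
    have hle : RankAux.W1 T ≤ Submodule.span ℂ (Set.range fun a => (R a).mulVecLin) := by
      refine Submodule.span_le.2 ?_
      rintro _ ⟨p, rfl⟩
      simp only [hT1]
      exact Submodule.sum_mem _ fun a _ =>
        Submodule.smul_mem _ _ (Submodule.subset_span ⟨a, rfl⟩)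
    refine (Submodule.finrank_mono hle).trans ?_
    simpa [Set.finrank] using finrank_range_le_card (R := ℂ) (fun a => (R a).mulVecLin)
  have h2 : Module.finrank ℂ (RankAux.W2 T) ≤ (∑ i, R i ⊗ₖ (S i)ᵀ).rank := by
    let ψ : (m₁ × n₂ → ℂ) →ₗ[ℂ] (n₂ → ℂ) →ₗ[ℂ] (m₁ → ℂ) :=
      LinearMap.mk₂ ℂ (fun v x i => ∑ l, v (i, l) * x l)
        (by intros; ext; simp [add_mul, Finset.sum_add_distrib])
        (by intros; ext; simp [Finset.mul_sum, mul_assoc])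
        (by intros; ext; simp [mul_add, Finset.sum_add_distrib])
        (by intros; ext; simp [Finset.mul_sum, mul_left_comm])
    have hle : RankAux.W2 T ≤ (LinearMap.range (∑ i, R i ⊗ₖ (S i)ᵀ).mulVecLin).map ψ := by
      refine Submodule.span_le.2 ?_
      rintro _ ⟨⟨y, b⟩, rfl⟩
      refine ⟨_, ⟨fun p => b p.1 * y p.2, rfl⟩, ?_⟩
      refine LinearMap.ext fun x => ?_
      change _ = T x y b
      rw [hTa]
      ext i
      simp only [ψ, LinearMap.mk₂_apply, mulVecLin_apply, Matrix.sum_mulVec, Finset.sum_apply,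
        Pi.smul_apply, smul_eq_mul, Finset.sum_mul]
      rw [Finset.sum_comm]
      refine Finset.sum_congr rfl fun a _ => ?_
      simp only [mulVec, dotProduct, Fintype.sum_prod_type, kroneckerMap_apply, transpose_apply,
        Finset.sum_mul, Finset.mul_sum]
      rw [Finset.sum_comm]
      refine Finset.sum_congr rfl fun j _ => ?_
      rw [Finset.sum_comm]
      refine Finset.sum_congr rfl fun k _ => ?_
      refine Finset.sum_congr rfl fun l _ => ?_
      ring
    exact (Submodule.finrank_mono hle).trans (Submodule.finrank_map_le _ _)
  have h3 : (∑ i, R i ⊗ₖ S i).rank ≤ Module.finrank ℂ (RankAux.W3 T) := by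
    let φ : ((m₂ → ℂ) →ₗ[ℂ] (m₁ → ℂ)) →ₗ[ℂ] (m₁ × m₂ → ℂ) :=
      { toFun := fun f p => f (Pi.single p.2 1) p.1
        map_add' := by intros; rfl
        map_smul' := by intros; rfl }
    rw [Matrix.rank_eq_finrank_span_cols]
    refine le_trans (Submodule.finrank_mono (t := (RankAux.W3 T).map φ) ?_)
      (Submodule.finrank_map_le _ _)
    refine Submodule.span_le.2 ?_
    rintro _ ⟨⟨j, l⟩, rfl⟩
    refine ⟨(T (Pi.single l 1)).flip (Pi.single j 1), Submodule.subset_span ⟨(_, _), rfl⟩, ?_⟩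
    ext ⟨i, k⟩
    change T (Pi.single l 1) (Pi.single k 1) (Pi.single j 1) i = _
    rw [hTa]
    simp [Matrix.sum_apply, mul_comm]
  calc _ ≤ _ := h3
    _ ≤ _ := RankAux.main _ T le_rfl
    _ ≤ _ := Nat.mul_le_mul h1 h2
end

section
/- Let n ≥ 2 and let t₀ ≥ t₁ ≥ ⋯ ≥ t_{n-2} > t_{n-1} ≥ 1 be natural numbers. Let M : Matrix (Fin t₀ × m₂) (Fin n₁ × n₂) ℂ with blocks M_{i,j}, where n ≤ n₁. Suppose: (a) the family of blocks {M_{i,j} : j ≤ n−1, i < t_j} (of cardinality t₀ + t₁ + ⋯ + t_{n-1}) is linearly independent; (b) for every i with t_{n-1} ≤ i < t₀, the block M_{i,n-1} lies in the span of {M_{a,b} : b ≤ n−2, a < t_b}; (c) there exist i₀ with t_{n-1} ≤ i₀ < t₀ and j₀ ≥ n such that M_{i₀,j₀} is not in the span of the family in (a). Then there exists a constant k ∈ ℂ such that the family {M_{a,b} : b ≤ n−2, a < t_b} ∪ {M_{i,n-1} + k • M_{i,j₀} : i < t₀} spans a subspace of Matrix m₂ n₂ ℂ of dimension at least t₀ +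 t₁ + ⋯ + t_{n-2} + t_{n-1} + 1. -/
open Matrix Submodule Module

theorem exists_ne_zero_linearIndependent_add_smul {ι V : Type*} [Fintype ι]
    [AddCommGroup V] [Module ℂ V] (v w : ι → V) (hv : LinearIndependent ℂ v) :
    ∃ k : ℂ, k ≠ 0 ∧ LinearIndependent ℂ (fun i => v i + k • w i) := by
  classical
  have hinj : LinearMap.ker (Fintype.linearCombination ℂ v) = ⊥ :=
    LinearMap.ker_eq_bot.2 hv.fintypeLinearCombination_injective
  obtain ⟨φ, hφ⟩ := LinearMap.exists_leftInverse_of_injective _ hinj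
  have hφv : ∀ i, φ (v i) = Pi.single i 1 := by
    intro i
    have := LinearMap.congr_fun hφ (Pi.single i (1 : ℂ))
    simpa [Fintype.linearCombination_apply_single] using this
  let A : Matrix ι ι ℂ := Matrix.of fun i => φ (w i)
  have hcont : Continuous (fun k : ℂ => (1 + k • A).det) := by
    apply Continuous.matrix_det
    fun_prop
  have hev : ∀ᶠ k in nhds (0 : ℂ), (1 + k • A).det ≠ 0 := by
    apply hcont.continuousAt.eventually_ne
    simp
  obtain ⟨k, hk, hk0⟩ := ((hev.filter_mono nhdsWithin_le_nhds).and
    (self_mem_nhdsWithin : {(0 : ℂ)}ᶜ ∈ nhdsWithin (0 : ℂ) {0}ᶜ)).exists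
  refine ⟨k, hk0, ?_⟩
  apply LinearIndependent.of_comp φ
  have h := Matrix.linearIndependent_rows_of_det_ne_zero hk
  have e : (φ ∘ fun i => v i + k • w i) = fun i => (1 + k • A) i := by
    funext i
    ext j
    simp [hφv, A, Matrix.one_apply, Pi.single_apply, eq_comm]
  rw [e]
  exact h

/-- Lemma 4(iii): let `t₀ ≥ t₁ ≥ ⋯ ≥ t_{n-2} > t_{n-1} ≥ 1`.  Suppose the blocks
`{M_{i,j} : j ≤ n-1, i < t_j}` are linearly independent, each block `M_{i,n-1}` with
`t_{n-1} ≤ i < t₀` lies in the span of `{M_{a,b} : b ≤ n-2, a < t_b}`, and some block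
`M_{i₀,j₀}` (with `t_{n-1} ≤ i₀`, `n ≤ j₀`) lies outside the span of the family above.
Then for some constant `k`, the family `{M_{a,b} : b ≤ n-2, a < t_b}` together with the
`(n-1)`-st block-column plus `k` times the `j₀`-th block-column spans a space of
dimension at least `t₀ + t₁ + ⋯ + t_{n-1} + 1`. -/
theorem exists_const_nth_column_update_dim_ge
    {n n₁ : ℕ} {m₂ n₂ : Type*} [Fintype m₂] [Fintype n₂]
    (hn : 2 ≤ n) (hnn₁ : n ≤ n₁)
    (t : Fin n → ℕ)
    (hmono : ∀ i j : Fin n, i ≤ j → t j ≤ t i)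
    (hlast : t ⟨n - 1, by omega⟩ < t ⟨n - 2, by omega⟩)
    (hone : 1 ≤ t ⟨n - 1, by omega⟩)
    (M : Matrix (Fin (t ⟨0, by omega⟩) × m₂) (Fin n₁ × n₂) ℂ)
    (ha : LinearIndependent ℂ
      (fun p : (j : Fin n) × Fin (t j) =>
        blockOf M
          ⟨p.2.val, lt_of_lt_of_le p.2.isLt
            (hmono ⟨0, by omega⟩ p.1 (by simp [Fin.le_def]))⟩
          ⟨p.1.val, lt_of_lt_of_le p.1.isLt hnn₁⟩))
    (hb : ∀ i : Fin (t ⟨0, by omega⟩), t ⟨n - 1, by omega⟩ ≤ i.val →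
      blockOf M i ⟨n - 1, by omega⟩ ∈ Submodule.span ℂ (Set.range
        (fun p : (j : Fin (n - 1)) ×
            Fin (t ⟨j.val, Nat.lt_of_lt_of_le j.isLt (Nat.sub_le n 1)⟩) =>
          blockOf M
            ⟨p.2.val, lt_of_lt_of_le p.2.isLt
              (hmono ⟨0, by omega⟩ ⟨p.1.val, Nat.lt_of_lt_of_le p.1.isLt (Nat.sub_le n 1)⟩
                (by simp [Fin.le_def]))⟩
            ⟨p.1.val, lt_of_lt_of_le p.1.isLt (le_trans (Nat.sub_le n 1) hnn₁)⟩)))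
    (i₀ : Fin (t ⟨0, by omega⟩)) (j₀ : Fin n₁)
    (hi₀ : t ⟨n - 1, by omega⟩ ≤ i₀.val) (hj₀ : n ≤ j₀.val)
    (hnot : blockOf M i₀ j₀ ∉ Submodule.span ℂ (Set.range
      (fun p : (j : Fin n) × Fin (t j) =>
        blockOf M
          ⟨p.2.val, lt_of_lt_of_le p.2.isLt
            (hmono ⟨0, by omega⟩ p.1 (by simp [Fin.le_def]))⟩
          ⟨p.1.val, lt_of_lt_of_le p.1.isLt hnn₁⟩))) :
    ∃ k : ℂ, (∑ j : Fin n, t j) + 1 ≤ Module.finrank ℂ (Submodule.span ℂ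
      (Set.range (Sum.elim
        (fun p : (j : Fin (n - 1)) ×
            Fin (t ⟨j.val, Nat.lt_of_lt_of_le j.isLt (Nat.sub_le n 1)⟩) =>
          blockOf M
            ⟨p.2.val, lt_of_lt_of_le p.2.isLt
              (hmono ⟨0, by omega⟩ ⟨p.1.val, Nat.lt_of_lt_of_le p.1.isLt (Nat.sub_le n 1)⟩
                (by simp [Fin.le_def]))⟩
            ⟨p.1.val, lt_of_lt_of_le p.1.isLt (le_trans (Nat.sub_le n 1) hnn₁)⟩)
        (fun i : Fin (t ⟨0, by omega⟩) =>
          blockOf M i ⟨n - 1, by omega⟩ + k • blockOf M i j₀)))) := by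
  classical
  have hopt := linearIndependent_option'.2 ⟨ha, hnot⟩
  let w : Option ((j : Fin n) × Fin (t j)) → Matrix m₂ n₂ ℂ := fun o =>
    Option.casesOn' o 0 (fun p => if p.1.val = n - 1 then
      blockOf M ⟨p.2.val, lt_of_lt_of_le p.2.isLt
            (hmono ⟨0, by omega⟩ p.1 (by simp [Fin.le_def]))⟩ j₀ else 0)
  obtain ⟨k, hk0, hk⟩ := exists_ne_zero_linearIndependent_add_smul _ w hopt
  refine ⟨k, ?_⟩
  have hcard := finrank_span_eq_card hk
  have hc : Fintype.card (Option ((j : Fin n) × Fin (t j))) = (∑ j : Fin n, t j) + 1 := by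
    simp
  rw [← hc, ← hcard]
  apply Submodule.finrank_mono
  rw [Submodule.span_le]
  rintro _ ⟨o, rfl⟩
  rcases o with _ | ⟨j, i⟩
  · simp only [w, Option.casesOn'_none, smul_zero, add_zero, SetLike.mem_coe]
    have h1 := Submodule.span_mono (R := ℂ) (Set.range_comp_subset_range Sum.inl (Sum.elim
        (fun p : (j : Fin (n - 1)) ×
            Fin (t ⟨j.val, Nat.lt_of_lt_of_le j.isLt (Nat.sub_le n 1)⟩) =>
          blockOf M
            ⟨p.2.val, lt_of_lt_of_le p.2.isLt
              (hmono ⟨0, by omega⟩ ⟨p.1.val, Nat.lt_of_lt_of_le p.1.isLt (Nat.sub_le n 1)⟩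
                (by simp [Fin.le_def]))⟩
            ⟨p.1.val, lt_of_lt_of_le p.1.isLt (le_trans (Nat.sub_le n 1) hnn₁)⟩)
        (fun i : Fin (t ⟨0, by omega⟩) =>
          blockOf M i ⟨n - 1, by omega⟩ + k • blockOf M i j₀))) (hb i₀ hi₀)
    have h2 := Submodule.smul_mem _ k⁻¹ (Submodule.sub_mem _
      (Submodule.subset_span (Set.mem_range_self (Sum.inr i₀))) h1)
    simpa [smul_smul, inv_mul_cancel₀ hk0] using h2
  · apply Submodule.subset_span
    by_cases hj : j.val = n - 1
    · refine ⟨Sum.inr ⟨i.val, lt_of_lt_of_le i.isLt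
            (hmono ⟨0, by omega⟩ j (by simp [Fin.le_def]))⟩, ?_⟩
      simp [w, hj]
    · refine ⟨Sum.inl ⟨⟨j.val, by omega⟩, i⟩, ?_⟩
      simp [w, hj]
end

section
/- Cyclic inequality: for every n ≥ 3 and every positive semidefinite n-partite matrix ρ, with indices read modulo n, ∏_{j=0}^{n-1} r(ρ_{{j, j+1}}) ≥ r(ρ_{{0}})², where ρ_{{j,j+1}} is the two-party reduction onto parties j and j+1 and ρ_{{0}} is the reduction onto party 0. -/
open Matrix
open scoped ComplexOrder

/-- Combine a function defined on `S` with a function defined on its complement. -/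
def glue {n : ℕ} {A : Fin n → Type*} (S : Finset (Fin n))
    (x : ∀ i : {i // i ∈ S}, A i.val) (z : ∀ i : {i // i ∉ S}, A i.val) :
    ∀ i, A i :=
  fun i => if h : i ∈ S then x ⟨i, h⟩ else z ⟨i, h⟩

/-- The reduced matrix (partial trace over the complement of `S`) of an `n`-partite
matrix. -/
noncomputable def reduceMat {n : ℕ} {A : Fin n → Type*} [∀ i, Fintype (A i)]
    (ρ : Matrix (∀ i, A i) (∀ i, A i) ℂ) (S : Finset (Fin n)) :
    Matrix (∀ i : {i // i ∈ S}, A i.val) (∀ i : {i // i ∈ S}, A i.val) ℂ :=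
  Matrix.of fun x y =>
    ∑ z : ∀ i : {i // i ∉ S}, A i.val, ρ (glue S x z) (glue S y z)


/-- weights separating digit strings -/
lemma digit_weights (ι : Type) [Fintype ι] (B : ℕ) : ∃ W : ι → ℕ, ∀ f g : ι → ℕ,
    (∀ i, f i < B) → (∀ i, g i < B) → ∑ i, W i * f i = ∑ i, W i * g i → f = g := by
  let e := Fintype.equivFin ι
  refine ⟨fun i => B ^ (e i : ℕ), fun f g hf hg h => ?_⟩
  have key : ∀ (f : ι → ℕ) (hf : ∀ i, f i < B), ∑ i, B ^ (e i : ℕ) * f i =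
      (finFunctionFinEquiv (fun k => (⟨f (e.symm k), hf _⟩ : Fin B)) : ℕ) := by
    intro f hf
    rw [finFunctionFinEquiv_apply]
    rw [← e.sum_comp]
    simp [mul_comm]
  rw [key f hf, key g hg] at h
  have h2 := finFunctionFinEquiv.injective (Fin.ext h)
  funext i
  have := congrFun h2 (e i)
  simpa using this

lemma loomis_whitney {σ X Y Z : Type*} [DecidableEq X] [DecidableEq Y] [DecidableEq Z]
    (S : Finset σ) (x : σ → X) (y : σ → Y) (z : σ → Z)
    (hinj : ∀ s ∈ S, ∀ t ∈ S, x s = x t → y s = y t → z s = z t → s = t) :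
    S.card ^ 2 ≤ (S.image fun s => (y s, z s)).card * (S.image fun s => (x s, y s)).card
      * (S.image fun s => (x s, z s)).card := by
  classical
  have hS : S.card = ∑ b ∈ S.image y, (S.filter fun s => y s = b).card :=
    Finset.card_eq_sum_card_fiberwise (fun s hs => Finset.mem_image_of_mem y hs)
  have hYZ : (S.image fun s => (y s, z s)).card =
      ∑ b ∈ S.image y, ((S.image fun s => (y s, z s)).filter fun q => q.1 = b).card := by
    refine Finset.card_eq_sum_card_fiberwise (fun q hq => ?_)
    obtain ⟨s, hs, rfl⟩ := Finset.mem_image.1 hq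
    exact Finset.mem_image_of_mem y hs
  have hXY : (S.image fun s => (x s, y s)).card =
      ∑ b ∈ S.image y, ((S.image fun s => (x s, y s)).filter fun q => q.2 = b).card := by
    refine Finset.card_eq_sum_card_fiberwise (fun q hq => ?_)
    obtain ⟨s, hs, rfl⟩ := Finset.mem_image.1 hq
    exact Finset.mem_image_of_mem y hs
  set N := (S.image fun s => (x s, z s)).card with hN
  have h1 : ∀ b, (S.filter fun s => y s = b).card ≤ N := by
    intro b
    refine Finset.card_le_card_of_injOn (fun s => (x s, z s)) ?_ ?_
    · intro s hs
      exact Finset.mem_image_of_mem (fun s => (x s, z s)) (Finset.mem_filter.1 hs).1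
    · intro s hs t ht h
      have hs := Finset.mem_filter.1 hs
      have ht := Finset.mem_filter.1 ht
      have h := Prod.mk.inj h
      exact hinj s hs.1 t ht.1 h.1 (hs.2.trans ht.2.symm) h.2
  have h2 : ∀ b, (S.filter fun s => y s = b).card ≤
      ((S.image fun s => (y s, z s)).filter fun q => q.1 = b).card *
      ((S.image fun s => (x s, y s)).filter fun q => q.2 = b).card := by
    intro b
    rw [← Finset.card_product]
    refine Finset.card_le_card_of_injOn (fun s => ((y s, z s), (x s, y s))) ?_ ?_
    · intro s hs
      have hs := Finset.mem_filter.1 hs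
      simp only [Finset.coe_product, Set.mem_prod, Finset.mem_coe, Finset.mem_filter]
      exact ⟨⟨Finset.mem_image_of_mem (fun s => (y s, z s)) hs.1, hs.2⟩,
        ⟨Finset.mem_image_of_mem (fun s => (x s, y s)) hs.1, hs.2⟩⟩
    · intro s hs t ht h
      have hs := Finset.mem_filter.1 hs
      have ht := Finset.mem_filter.1 ht
      simp only [Prod.mk.injEq] at h
      exact hinj s hs.1 t ht.1 h.2.1 h.1.1 h.1.2
  have cs := Finset.sum_sq_le_sum_mul_sum_of_sq_le_mul (R := ℝ) (S.image y)
    (r := fun b => ((S.filter fun s => y s = b).card : ℝ))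
    (f := fun b => (((S.image fun s => (y s, z s)).filter fun q => q.1 = b).card : ℝ))
    (g := fun b => (((S.image fun s => (x s, y s)).filter fun q => q.2 = b).card : ℝ) * N)
    (fun _ _ => by positivity) (fun _ _ => by positivity)
    (fun b _ => by
      have := Nat.mul_le_mul (h2 b) (h1 b)
      rw [← sq, mul_assoc] at this
      exact_mod_cast this)
  rw [← Finset.sum_mul, ← mul_assoc] at cs
  rw [hYZ, hXY, hS]
  exact_mod_cast cs

lemma triangular_rank {I J K σ : Type*} [Fintype I] [Fintype J] [DecidableEq K]
    (N : Matrix I J ℂ) (S : Finset σ) (π : σ → K) (p : σ → I) (w : σ → I → ℂ) (ω : I → ℕ)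
    (hw : ∀ s ∈ S, w s ∈ Submodule.span ℂ (Set.range N.col))
    (hne : ∀ s ∈ S, w s (p s) ≠ 0)
    (htri : ∀ s ∈ S, ∀ i, w s i ≠ 0 → ω i ≤ ω (p s))
    (hinj : ∀ s ∈ S, ∀ t ∈ S, ω (p s) = ω (p t) → π s = π t) :
    (S.image π).card ≤ N.rank := by
  classical
  have hch : ∀ k : {k // k ∈ S.image π}, ∃ s, s ∈ S ∧ π s = k.1 := fun k =>
    Finset.mem_image.1 k.2
  choose c hc hπ using hch
  have hli : LinearIndependent ℂ (fun k => w (c k)) := by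
    rw [Fintype.linearIndependent_iff]
    intro g hg
    by_contra! hcon
    obtain ⟨k0, hk0⟩ := hcon
    obtain ⟨k, hk, hmax⟩ := Finset.exists_max_image
      (Finset.univ.filter fun k => g k ≠ 0) (fun k => ω (p (c k))) ⟨k0, by simpa using hk0⟩
    have hk : g k ≠ 0 := by simpa using hk
    have h := congrFun hg (p (c k))
    rw [Finset.sum_apply, Finset.sum_eq_single k] at h
    · simp [hk, hne _ (hc k)] at h
    · intro l _ hl
      by_contra hnz
      simp only [Pi.smul_apply, smul_eq_mul, mul_eq_zero, not_or] at hnz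
      have a1 := hmax l (by simpa using hnz.1)
      have a2 := htri _ (hc l) _ hnz.2
      have a3 := hinj _ (hc l) _ (hc k) (le_antisymm a1 a2)
      rw [hπ, hπ] at a3
      exact hl (Subtype.ext a3)
    · simp
  rw [Matrix.rank_eq_finrank_span_cols]
  have h1 := finrank_span_eq_card hli
  rw [← Fintype.card_coe, ← h1]
  apply Submodule.finrank_mono
  rw [Submodule.span_le]
  rintro _ ⟨k, rfl⟩
  exact hw _ (hc k)

lemma exists_leading {I J : Type*} [Fintype I] [Fintype J] (M : Matrix I J ℂ) (ω : J → ℕ) :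
    ∃ S : Finset J, M.rank ≤ S.card ∧ ∀ s ∈ S, ∃ u : I → ℂ,
      (∑ a, u a * M a s) ≠ 0 ∧ ∀ t, (∑ a, u a * M a t) ≠ 0 → ω t ≤ ω s := by
  classical
  refine ⟨Finset.univ.filter fun s => ∃ u : I → ℂ,
      (∑ a, u a * M a s) ≠ 0 ∧ ∀ t, (∑ a, u a * M a t) ≠ 0 → ω t ≤ ω s, ?_, ?_⟩
  swap
  · intro s hs
    simpa using hs
  set S := Finset.univ.filter fun s => ∃ u : I → ℂ,
      (∑ a, u a * M a s) ≠ 0 ∧ ∀ t, (∑ a, u a * M a t) ≠ 0 → ω t ≤ ω s with hS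
  rw [← Matrix.rank_transpose, Matrix.rank]
  let R : (J → ℂ) →ₗ[ℂ] (S → ℂ) := LinearMap.funLeft ℂ ℂ (fun s : S => s.1)
  have hinj : Function.Injective (R.comp (LinearMap.range Mᵀ.mulVecLin).subtype) := by
    rw [← LinearMap.ker_eq_bot, LinearMap.ker_eq_bot']
    rintro ⟨v, u, rfl⟩ hv
    by_contra hne
    have hne' : ∃ t, (Mᵀ.mulVecLin u) t ≠ 0 := by
      by_contra! h
      exact hne (Subtype.ext (funext h))
    have hval : ∀ t, (Mᵀ.mulVecLin u) t = ∑ a, u a * M a t := by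
      intro t
      simp [Matrix.vecMul, dotProduct]
    obtain ⟨t0, ht0⟩ := hne'
    obtain ⟨s, hs, hmax⟩ := Finset.exists_max_image
      (Finset.univ.filter fun t => (Mᵀ.mulVecLin u) t ≠ 0) ω ⟨t0, by simpa using ht0⟩
    have hs : (Mᵀ.mulVecLin u) s ≠ 0 := (Finset.mem_filter.1 hs).2
    have hsS : s ∈ S := by
      rw [hS, Finset.mem_filter]
      refine ⟨Finset.mem_univ _, u, ?_, fun t ht => ?_⟩
      · rwa [← hval]
      · exact hmax t (Finset.mem_filter.2 ⟨Finset.mem_univ _, by rwa [hval]⟩)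
    exact hs (congrFun hv ⟨s, hsS⟩)
  have := LinearMap.finrank_le_finrank_of_injective hinj
  simpa using this

lemma sum_split {n : ℕ} (T : Finset (Fin n)) (f : Fin n → ℕ) :
    ∑ i, f i = ∑ i : {i // i ∈ T}, f i.1 + ∑ i : {i // i ∉ T}, f i.1 := by
  rw [← Fintype.sum_subtype_add_sum_subtype (fun i => i ∈ T)]
  congr!

/-- The flattening of an amplitude tensor along `T`. -/
def flat {n : ℕ} {A : Fin n → Type*} {E : Type*} (φ : (∀ i, A i) → E → ℂ) (T : Finset (Fin n)) :
    Matrix (∀ i : {i // i ∈ T}, A i.val) ((∀ i : {i // i ∉ T}, A i.val) × E) ℂ :=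
  Matrix.of fun x ze => φ (glue T x ze.1) ze.2

lemma rank_reduceMat {n : ℕ} {A : Fin n → Type*} [∀ i, Fintype (A i)] {E : Type*} [Fintype E]
    (ρ : Matrix (∀ i, A i) (∀ i, A i) ℂ) (φ : (∀ i, A i) → E → ℂ)
    (h : ∀ x y, ρ x y = ∑ e, φ x e * star (φ y e)) (T : Finset (Fin n)) :
    (reduceMat ρ T).rank = (flat φ T).rank := by
  classical
  rw [← Matrix.rank_self_mul_conjTranspose (flat φ T)]
  congr 1
  ext x y
  simp [reduceMat, flat, Matrix.mul_apply, Fintype.sum_prod_type, h]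

lemma glue_restrict {n : ℕ} {A : Fin n → Type*} (T : Finset (Fin n)) (s : ∀ i, A i) :
    glue T (fun i => s i.1) (fun i => s i.1) = s := by
  funext i
  simp [glue]

lemma sum_glue {n : ℕ} {A : Fin n → Type*} (wt : ∀ i, A i → ℕ) (T : Finset (Fin n))
    (x : ∀ i : {i // i ∈ T}, A i.val) (z : ∀ i : {i // i ∉ T}, A i.val) :
    ∑ i, wt i (glue T x z i) =
      ∑ i : {i // i ∈ T}, wt i.1 (x i) + ∑ i : {i // i ∉ T}, wt i.1 (z i) := by
  rw [sum_split T]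
  congr 1
  · exact Finset.sum_congr rfl fun i _ => by simp [glue, i.2]
  · exact Finset.sum_congr rfl fun i _ => by simp [glue, i.2]

lemma row_bound {n : ℕ} {A : Fin n → Type*} [∀ i, Fintype (A i)] {E : Type*} [Fintype E]
    (φ : (∀ i, A i) → E → ℂ) (z0 : Fin n) (wt : ∀ i, A i → ℕ) (wtE : E → ℕ)
    (S : Finset ((∀ i, A i) × E)) (u : ((∀ i, A i) × E) → A z0 → ℂ)
    (hne : ∀ s ∈ S, ∑ a, u s a * φ (Function.update s.1 z0 a) s.2 ≠ 0)
    (hle : ∀ s ∈ S, ∀ t e, ∑ a, u s a * φ (Function.update t z0 a) e ≠ 0 →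
      ∑ i, wt i (t i) + wtE e ≤ ∑ i, wt i (s.1 i) + wtE s.2)
    (T : Finset (Fin n)) (h0 : z0 ∉ T) {K : Type*} [DecidableEq K] (π : ((∀ i, A i) × E) → K)
    (hinj : ∀ s ∈ S, ∀ t ∈ S, ∑ i : {i // i ∈ T}, wt i.1 (s.1 i.1) =
      ∑ i : {i // i ∈ T}, wt i.1 (t.1 i.1) → π s = π t) :
    (S.image π).card ≤ (flat φ T).rank := by
  classical
  refine triangular_rank (flat φ T) S π (fun s i => s.1 i.1)
    (fun s x => ∑ a, u s a *
      φ (Function.update (glue T x (fun i => s.1 i.1)) z0 a) s.2)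
    (fun x => ∑ i, wt i.1 (x i)) ?_ ?_ ?_ hinj
  · intro s _
    have : (fun x => ∑ a, u s a *
        φ (Function.update (glue T x (fun i => s.1 i.1)) z0 a) s.2) =
        ∑ a, u s a • (flat φ T).col (fun i => Function.update s.1 z0 a i.1, s.2) := by
      funext x
      simp only [Finset.sum_apply, Pi.smul_apply, smul_eq_mul, Matrix.col, flat,
        Matrix.transpose_apply, Matrix.of_apply]
      refine Finset.sum_congr rfl fun a _ => ?_
      congr 2
      funext i
      by_cases hi : i = z0
      · subst hi
        simp [glue, h0]
      · simp [glue, hi]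
    rw [this]
    exact Submodule.sum_mem _ fun a _ => Submodule.smul_mem _ _
      (Submodule.subset_span ⟨_, rfl⟩)
  · intro s hs
    simp only [glue_restrict]
    exact hne s hs
  · intro s hs x hx
    have := hle s hs _ _ hx
    rw [sum_glue] at this
    have h2 := sum_glue wt T (fun i => s.1 i.1) (fun i => s.1 i.1)
    rw [glue_restrict] at h2
    dsimp only
    omega

lemma col_bound {n : ℕ} {A : Fin n → Type*} [∀ i, Fintype (A i)] {E : Type*} [Fintype E]
    (φ : (∀ i, A i) → E → ℂ) (z0 : Fin n) (wt : ∀ i, A i → ℕ) (wtE : E → ℕ)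
    (S : Finset ((∀ i, A i) × E)) (u : ((∀ i, A i) × E) → A z0 → ℂ)
    (hne : ∀ s ∈ S, ∑ a, u s a * φ (Function.update s.1 z0 a) s.2 ≠ 0)
    (hle : ∀ s ∈ S, ∀ t e, ∑ a, u s a * φ (Function.update t z0 a) e ≠ 0 →
      ∑ i, wt i (t i) + wtE e ≤ ∑ i, wt i (s.1 i) + wtE s.2)
    (T : Finset (Fin n)) (h0 : z0 ∈ T) {K : Type*} [DecidableEq K] (π : ((∀ i, A i) × E) → K)
    (hinj : ∀ s ∈ S, ∀ t ∈ S, ∑ i : {i // i ∉ T}, wt i.1 (s.1 i.1) + wtE s.2 =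
      ∑ i : {i // i ∉ T}, wt i.1 (t.1 i.1) + wtE t.2 → π s = π t) :
    (S.image π).card ≤ (flat φ T).rank := by
  classical
  rw [← Matrix.rank_transpose]
  refine triangular_rank (flat φ T)ᵀ S π (fun s => (fun i => s.1 i.1, s.2))
    (fun s ze => ∑ a, u s a *
      φ (Function.update (glue T (fun i => s.1 i.1) ze.1) z0 a) ze.2)
    (fun ze => ∑ i, wt i.1 (ze.1 i) + wtE ze.2) ?_ ?_ ?_ hinj
  · intro s _
    have : (fun ze : (∀ i : {i // i ∉ T}, A i.val) × E => ∑ a, u s a *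
        φ (Function.update (glue T (fun i => s.1 i.1) ze.1) z0 a) ze.2) =
        ∑ a, u s a • (flat φ T)ᵀ.col (fun i => Function.update s.1 z0 a i.1) := by
      funext x
      simp only [Finset.sum_apply, Pi.smul_apply, smul_eq_mul, Matrix.col, flat,
        Matrix.transpose_apply, Matrix.of_apply]
      refine Finset.sum_congr rfl fun a _ => ?_
      congr 2
      funext i
      by_cases hi : i = z0
      · subst hi
        simp [glue, h0]
      · simp [glue, hi]
    rw [this]
    exact Submodule.sum_mem _ fun a _ => Submodule.smul_mem _ _
      (Submodule.subset_span ⟨_, rfl⟩)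
  · intro s hs
    simp only [glue_restrict]
    exact hne s hs
  · intro s hs x hx
    have := hle s hs _ _ hx
    rw [sum_glue] at this
    have h2 := sum_glue wt T (fun i => s.1 i.1) (fun i => s.1 i.1)
    rw [glue_restrict] at h2
    dsimp only
    omega

lemma exists_weights {n : ℕ} {A : Fin n → Type*} [∀ i, Fintype (A i)] {E : Type*} [Fintype E]
    (z0 : Fin n) : ∃ (wt : ∀ i, A i → ℕ) (wtE : E → ℕ), (∀ a, wt z0 a = 0) ∧
      (∀ (T : Finset (Fin n)) (s t : ∀ i, A i), ∑ i : {i // i ∈ T}, wt i.1 (s i.1) =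
        ∑ i : {i // i ∈ T}, wt i.1 (t i.1) → ∀ i ∈ T, i ≠ z0 → s i = t i) ∧
      (∀ (T : Finset (Fin n)) (s t : ∀ i, A i) (e f : E),
        ∑ i : {i // i ∉ T}, wt i.1 (s i.1) + wtE e =
        ∑ i : {i // i ∉ T}, wt i.1 (t i.1) + wtE f →
          e = f ∧ ∀ i ∉ T, i ≠ z0 → s i = t i) := by
  classical
  let B := Fintype.card E + ∑ i, Fintype.card (A i) + 1
  obtain ⟨W, hW⟩ := digit_weights (Option (Fin n)) B
  let enc : ∀ i, A i → ℕ := fun i a => (Fintype.equivFin (A i) a : ℕ)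
  let encE : E → ℕ := fun a => (Fintype.equivFin E a : ℕ)
  have henc : ∀ i a, enc i a < B := by
    intro i a
    have h1 : enc i a < Fintype.card (A i) := (Fintype.equivFin (A i) a).2
    have h2 : Fintype.card (A i) ≤ ∑ i, Fintype.card (A i) :=
      Finset.single_le_sum (f := fun i => Fintype.card (A i)) (fun _ _ => Nat.zero_le _)
        (Finset.mem_univ i)
    omega
  have hencE : ∀ a, encE a < B := by
    intro a
    have h1 : encE a < Fintype.card E := (Fintype.equivFin E a).2
    omega
  have hi : ∀ i a b, enc i a = enc i b → a = b := fun i a b h =>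
    (Fintype.equivFin (A i)).injective (Fin.ext h)
  have hiE : ∀ a b, encE a = encE b → a = b := fun a b h =>
    (Fintype.equivFin E).injective (Fin.ext h)
  have hB : 0 < B := by omega
  refine ⟨fun i a => if i = z0 then 0 else W (some i) * enc i a,
    fun e => W none * encE e, by simp, ?_, ?_⟩
  · intro T s t h i hiT hi0
    have key : ∀ s : ∀ i, A i,
        ∑ i : {i // i ∈ T}, (if i.1 = z0 then 0 else W (some i.1) * enc i.1 (s i.1)) =
        ∑ o : Option (Fin n), W o *
          (o.elim 0 fun i => if i ∈ T ∧ i ≠ z0 then enc i (s i) else 0) := by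
      intro s
      rw [Fintype.sum_option, sum_split T]
      have h2 : ∑ i : {i // i ∉ T}, W (some i.1) *
          ((some i.1 : Option (Fin n)).elim 0
            fun i => if i ∈ T ∧ i ≠ z0 then enc i (s i) else 0) = 0 :=
        Finset.sum_eq_zero fun i _ => by simp [i.2]
      rw [h2]
      simp only [Option.elim_none, mul_zero, zero_add, add_zero]
      refine Finset.sum_congr rfl fun i _ => ?_
      by_cases h : i.1 = z0 <;> simp [h, i.2]
    rw [key, key] at h
    have h3 := congrFun (hW _ _ ?_ ?_ h) (some i)
    · simp only [Option.elim_some, hiT, hi0, ne_eq, not_false_eq_true, and_self, if_true] at h3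
      exact hi i _ _ h3
    all_goals
      rintro (_ | i)
      · exact hB
      · simp only [Option.elim_some]
        split_ifs
        · exact henc _ _
        · exact hB
  · intro T s t e f h
    have key : ∀ (s : ∀ i, A i) (e : E),
        ∑ i : {i // i ∉ T}, (if i.1 = z0 then 0 else W (some i.1) * enc i.1 (s i.1))
          + W none * encE e =
        ∑ o : Option (Fin n), W o *
          (o.elim (encE e) fun i => if i ∉ T ∧ i ≠ z0 then enc i (s i) else 0) := by
      intro s e
      rw [Fintype.sum_option, sum_split T]
      have h2 : ∑ i : {i // i ∈ T}, W (some i.1) *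
          ((some i.1 : Option (Fin n)).elim (encE e)
            fun i => if i ∉ T ∧ i ≠ z0 then enc i (s i) else 0) = 0 :=
        Finset.sum_eq_zero fun i _ => by simp [i.2]
      rw [h2]
      simp only [Option.elim_none, zero_add]
      rw [add_comm]
      congr 1
      refine Finset.sum_congr rfl fun i _ => ?_
      by_cases h : i.1 = z0 <;> simp [h, i.2]
    rw [key, key] at h
    have h4 := hW _ _ ?_ ?_ h
    · refine ⟨hiE _ _ (congrFun h4 none), fun i hiT hi0 => ?_⟩
      have h3 := congrFun h4 (some i)
      simp only [Option.elim_some, hiT, hi0, ne_eq, not_false_eq_true, and_self, if_true] at h3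
      exact hi i _ _ h3
    all_goals
      rintro (_ | i)
      · exact hencE _
      · simp only [Option.elim_some]
        split_ifs
        · exact henc _ _
        · exact hB

lemma exists_leading_flat {n : ℕ} {A : Fin n → Type*} [∀ i, Fintype (A i)] {E : Type*}
    [Fintype E] (φ : (∀ i, A i) → E → ℂ) (z0 : Fin n) (wt : ∀ i, A i → ℕ) (wtE : E → ℕ)
    (hz : ∀ a, wt z0 a = 0) (a0 : A z0) :
    ∃ S : Finset ((∀ i, A i) × E), (flat φ {z0}).rank ≤ S.card ∧ (∀ s ∈ S, s.1 z0 = a0) ∧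
      ∃ u : ((∀ i, A i) × E) → A z0 → ℂ,
      (∀ s ∈ S, ∑ a, u s a * φ (Function.update s.1 z0 a) s.2 ≠ 0) ∧
      (∀ s ∈ S, ∀ t e, ∑ a, u s a * φ (Function.update t z0 a) e ≠ 0 →
      ∑ i, wt i (t i) + wtE e ≤ ∑ i, wt i (s.1 i) + wtE s.2) := by
  classical
  obtain ⟨S, hS, hu⟩ := exists_leading (flat φ {z0})
    (fun ze => ∑ i, wt i.1 (ze.1 i) + wtE ze.2)
  -- functions on the singleton
  let sg : A z0 → ∀ i : {i // i ∈ ({z0} : Finset (Fin n))}, A i.1 :=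
    fun a i => (Finset.mem_singleton.1 i.2).symm ▸ a
  have hsg : ∀ a h, sg a ⟨z0, h⟩ = a := fun a h => rfl
  have hsb : Function.Bijective sg := by
    constructor
    · intro a b h
      exact congrFun h ⟨z0, by simp⟩
    · intro x
      refine ⟨x ⟨z0, by simp⟩, ?_⟩
      funext ⟨i, hi⟩
      have : i = z0 := by simpa using hi
      subst this
      rfl
  let ι : ((∀ i : {i // i ∉ ({z0} : Finset (Fin n))}, A i.1) × E) → (∀ i, A i) × E :=
    fun ze => (glue {z0} (sg a0) ze.1, ze.2)
  let r : (∀ i, A i) × E → ((∀ i : {i // i ∉ ({z0} : Finset (Fin n))}, A i.1) × E) :=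
    fun s => (fun i => s.1 i.1, s.2)
  have hr : ∀ ze, r (ι ze) = ze := by
    rintro ⟨z, e⟩
    refine Prod.ext (funext fun i => ?_) rfl
    have := i.2
    simp only [r, ι, glue]
    rw [dif_neg this]
  have hupd : ∀ (t : ∀ i, A i) (a : A z0),
      Function.update t z0 a = glue {z0} (sg a) (fun i => t i.1) := by
    intro t a
    funext i
    by_cases hi : i = z0
    · subst hi
      simp [glue, hsg]
    · simp [glue, hi]
  have hsum : ∀ (u : _ → ℂ) (t : ∀ i, A i) (e : E),
      ∑ a, u (sg a) * φ (Function.update t z0 a) e = ∑ x, u x * flat φ {z0} x (r (t, e)) := by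
    intro u t e
    rw [← hsb.sum_comp]
    refine Finset.sum_congr rfl fun a _ => ?_
    rw [hupd]
    rfl
  have hwt : ∀ (t : ∀ i, A i), ∑ i, wt i (t i) =
      ∑ i : {i // i ∉ ({z0} : Finset (Fin n))}, wt i.1 (t i.1) := by
    intro t
    rw [sum_split {z0}]
    rw [Finset.sum_eq_zero, zero_add]
    rintro ⟨i, hi⟩ _
    have : i = z0 := by simpa using hi
    subst this
    exact hz _
  choose! u hu1 hu2 using hu
  refine ⟨S.image ι, ?_, ?_, fun s a => u (r s) (sg a), ?_, ?_⟩
  · rw [Finset.card_image_of_injective _ (Function.LeftInverse.injective hr)]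
    exact hS
  · intro s hs
    obtain ⟨ze, _, rfl⟩ := Finset.mem_image.1 hs
    simp [ι, glue, hsg]
  · intro s hs
    obtain ⟨ze, hze, rfl⟩ := Finset.mem_image.1 hs
    rw [hsum (u (r (ι ze)))]
    have h1 := hu1 ze hze
    rw [← hr ze] at h1
    exact h1
  · intro s hs t e hne
    obtain ⟨ze, hze, rfl⟩ := Finset.mem_image.1 hs
    rw [hsum (u (r (ι ze))), hr] at hne
    have h2 := hu2 ze hze _ hne
    rw [hwt, hwt]
    rw [← hr ze] at h2
    exact h2

open scoped MatrixOrder in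
lemma psd_factor {ι : Type*} [Fintype ι] [DecidableEq ι] (ρ : Matrix ι ι ℂ) (h : ρ.PosSemidef) :
    ∃ C : Matrix ι ι ℂ, ρ = Cᴴ * C :=
  CStarAlgebra.nonneg_iff_eq_star_mul_self.mp h.nonneg

/-- Cyclic inequality: for a positive semidefinite `n`-partite matrix (`n ≥ 3`), the
product of the ranks of the nearest-neighbour two-party reductions (indices mod `n`)
is at least the square of the rank of the reduction onto party `0`. -/
theorem prod_rank_cyclic_pairs_ge_rank_single_sq
    {n : ℕ} (hn : 3 ≤ n) {A : Fin n → Type*}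
    [∀ i, Fintype (A i)] [∀ i, DecidableEq (A i)]
    (ρ : Matrix (∀ i, A i) (∀ i, A i) ℂ) (hρ : ρ.PosSemidef) :
    ∏ j : Fin n,
        (reduceMat ρ {j, ⟨(j.val + 1) % n, Nat.mod_lt _ (by omega)⟩}).rank ≥
      (reduceMat ρ {⟨0, by omega⟩}).rank ^ 2 := by
  classical
  obtain ⟨C, hC⟩ := psd_factor ρ hρ
  let φ : (∀ i, A i) → (∀ i, A i) → ℂ := fun x e => star (C e x)
  have hφ : ∀ x y, ρ x y = ∑ e, φ x e * star (φ y e) := by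
    intro x y
    rw [hC]
    simp [φ, Matrix.mul_apply]
  simp only [rank_reduceMat ρ φ hφ]
  set z0 : Fin n := ⟨0, by omega⟩ with hz0
  rcases isEmpty_or_nonempty (A z0) with hemp | ⟨⟨a0⟩⟩
  · have : IsEmpty (∀ i : {i // i ∈ ({z0} : Finset (Fin n))}, A i.1) :=
      ⟨fun x => hemp.elim (x ⟨z0, by simp⟩)⟩
    have h0 : (flat φ {z0}).rank = 0 := by
      have := Matrix.rank_le_card_height (flat φ {z0})
      simpa using this
    rw [h0]
    simp
  obtain ⟨wt, wtE, hz, hW, hWE⟩ := exists_weights (A := A) (E := ∀ i, A i) z0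
  obtain ⟨S, hS, hSa, u, hne, hle⟩ := exists_leading_flat φ z0 wt wtE hz a0
  rcases S.eq_empty_or_nonempty with rfl | hSne
  · have h0 : (flat φ {z0}).rank = 0 := by simpa using hS
    rw [h0]
    simp
  let T : Fin n → Finset (Fin n) := fun j =>
    {j, ⟨(j.val + 1) % n, Nat.mod_lt _ (by omega)⟩}
  change (flat φ {z0}).rank ^ 2 ≤ ∏ j : Fin n, (flat φ (T j)).rank
  let o : Fin n := ⟨1, by omega⟩
  let l : Fin n := ⟨n - 1, by omega⟩
  let m : Fin n := ⟨n - 2, by omega⟩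
  have hT0 : T z0 = {z0, o} := by
    have : 1 % n = 1 := Nat.mod_eq_of_lt (by omega)
    simp [T, z0, o, this]
  have hTl : T l = {l, z0} := by
    have : (n - 1 + 1) % n = 0 := by
      rw [Nat.sub_add_cancel (by omega)]
      exact Nat.mod_self n
    simp [T, z0, l, this]
  have hTm : T m = {m, l} := by
    have : (n - 2 + 1) % n = n - 1 := by
      rw [Nat.mod_eq_of_lt (by omega)]
      omega
    simp [T, m, l, this]
  have hTo : o ∈ T o := by simp [T]
  have hT0' : ∀ j, j ≠ z0 → j ≠ l → z0 ∉ T j := by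
    intro j h1 h2
    have hj := j.2
    have h1 : j.val ≠ 0 := fun h => h1 (Fin.ext h)
    have h2 : j.val ≠ n - 1 := fun h => h2 (Fin.ext h)
    have : (j.val + 1) % n = j.val + 1 := Nat.mod_eq_of_lt (by omega)
    simp only [T, Finset.mem_insert, Finset.mem_singleton, Fin.ext_iff, z0, this]
    omega
  have hpos : ∀ j, 1 ≤ (flat φ (T j)).rank := by
    intro j
    have hone : (S.image fun _ => ()).card = 1 := by
      rw [Finset.image_const hSne]
      simp
    rw [← hone]
    by_cases h : z0 ∈ T j
    · exact col_bound φ z0 wt wtE S u hne hle (T j) h _ fun _ _ _ _ _ => rfl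
    · exact row_bound φ z0 wt wtE S u hne hle (T j) h _ fun _ _ _ _ _ => rfl
  have hol : o ≠ l := by
    simp only [o, l, ne_eq, Fin.ext_iff]
    omega
  have h0o : z0 ≠ o := by simp [z0, o, Fin.ext_iff]
  have h0l : z0 ≠ l := by
    simp only [z0, l, ne_eq, Fin.ext_iff]
    omega
  -- the three coordinates
  let y : ((∀ i, A i) × (∀ i, A i)) →
      (∀ i : {i : Fin n // i ≠ o ∧ i ≠ l}, A i.1) × (∀ i, A i) := fun s => (fun i => s.1 i.1, s.2)
  have lw := loomis_whitney S (fun s => s.1 o) y (fun s => s.1 l) (by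
    intro s _ t _ h1 h2 h3
    have h2 := Prod.mk.inj h2
    refine Prod.ext (funext fun i => ?_) h2.2
    by_cases hi : i = o
    · subst hi
      exact h1
    by_cases hi' : i = l
    · subst hi'
      exact h3
    exact congrFun h2.1 ⟨i, hi, hi'⟩)
  have b1 : (S.image fun s => (y s, s.1 l)).card ≤ (flat φ (T z0)).rank := by
    refine col_bound φ z0 wt wtE S u hne hle (T z0) (by simp [T]) _ ?_
    intro s hs t ht h
    obtain ⟨he, hi⟩ := hWE _ _ _ _ _ h
    have hi' : ∀ i, i ≠ o → s.1 i = t.1 i := by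
      intro i hio
      by_cases h0 : i = z0
      · subst h0
        rw [hSa s hs, hSa t ht]
      · exact hi i (by rw [hT0]; simp [h0, hio]) h0
    exact Prod.ext (Prod.ext (funext fun i => hi' i.1 i.2.1) he) (hi' l hol.symm)
  have b2 : (S.image fun s => (s.1 o, y s)).card ≤ (flat φ (T l)).rank := by
    refine col_bound φ z0 wt wtE S u hne hle (T l) (by rw [hTl]; simp) _ ?_
    intro s hs t ht h
    obtain ⟨he, hi⟩ := hWE _ _ _ _ _ h
    have hi' : ∀ i, i ≠ l → s.1 i = t.1 i := by
      intro i hio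
      by_cases h0 : i = z0
      · subst h0
        rw [hSa s hs, hSa t ht]
      · exact hi i (by rw [hTl]; simp [h0, hio]) h0
    exact Prod.ext (hi' o hol) (Prod.ext (funext fun i => hi' i.1 i.2.2) he)
  have hfin : S.card ^ 2 ≤ ∏ j : Fin n, (flat φ (T j)).rank := by
    refine lw.trans ((Nat.mul_le_mul_right _ (Nat.mul_le_mul b1 b2)).trans ?_)
    by_cases hn3 : n = 3
    · have hmo : m = o := Fin.ext (by simp [m, o, hn3])
      have hTo' : T o = {o, l} := by rw [← hmo, hTm]
      have b3 : (S.image fun s => (s.1 o, s.1 l)).card ≤ (flat φ (T o)).rank := by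
        refine row_bound φ z0 wt wtE S u hne hle (T o) (hT0' o h0o.symm hol) _ ?_
        intro s hs t ht h
        have hi := hW _ _ _ h
        exact Prod.ext (hi o (by rw [hTo']; simp) h0o.symm) (hi l (by rw [hTo']; simp) h0l.symm)
      calc _ ≤ _ := Nat.mul_le_mul_left _ b3
        _ = ∏ j ∈ {z0, l, o}, (flat φ (T j)).rank := by
          rw [Finset.prod_insert (by simp [h0o, h0l]), Finset.prod_insert (by simp [hol.symm]),
            Finset.prod_singleton, mul_assoc]
        _ ≤ _ := Finset.prod_le_prod_of_subset_of_one_le' (Finset.subset_univ _)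
          fun j _ _ => hpos j
    · have hmo : o ≠ m := by
        simp only [o, m, ne_eq, Fin.ext_iff]
        omega
      have h0m : z0 ≠ m := by
        simp only [z0, m, ne_eq, Fin.ext_iff]
        omega
      have hml : m ≠ l := by
        simp only [l, m, ne_eq, Fin.ext_iff]
        omega
      have c1 : (S.image fun s => s.1 o).card ≤ (flat φ (T o)).rank := by
        refine row_bound φ z0 wt wtE S u hne hle (T o) (hT0' o h0o.symm hol) _ ?_
        intro s hs t ht h
        exact hW _ _ _ h o hTo h0o.symm
      have c2 : (S.image fun s => s.1 l).card ≤ (flat φ (T m)).rank := by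
        refine row_bound φ z0 wt wtE S u hne hle (T m) (hT0' m h0m.symm hml) _ ?_
        intro s hs t ht h
        exact hW _ _ _ h l (by rw [hTm]; simp) h0l.symm
      have b3 : (S.image fun s => (s.1 o, s.1 l)).card ≤
          (S.image fun s => s.1 o).card * (S.image fun s => s.1 l).card := by
        rw [← Finset.card_product]
        refine Finset.card_le_card fun q hq => ?_
        obtain ⟨s, hs, rfl⟩ := Finset.mem_image.1 hq
        exact Finset.mem_product.2 ⟨Finset.mem_image_of_mem (fun s => s.1 o) hs,
          Finset.mem_image_of_mem (fun s => s.1 l) hs⟩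
      calc _ ≤ _ := Nat.mul_le_mul_left _ (b3.trans (Nat.mul_le_mul c1 c2))
        _ = ∏ j ∈ {z0, l, o, m}, (flat φ (T j)).rank := by
          rw [Finset.prod_insert (by simp [h0o, h0l, h0m]),
            Finset.prod_insert (by simp [hol.symm, hml.symm]),
            Finset.prod_insert (by simp [hmo]),
            Finset.prod_singleton, mul_assoc]
        _ ≤ _ := Finset.prod_le_prod_of_subset_of_one_le' (Finset.subset_univ _)
          fun j _ _ => hpos j
  exact (Nat.pow_le_pow_left hS 2).trans hfin
end

section
/- Path inequality: for every n ≥ 2 and every positive semidefinite n-partite matrix ρ, ∏_{j=0}^{n-2} r(ρ_{{j, j+1}}) ≥ r(ρ_{{0, n-1}}), where ρ_{{j,j+1}} is the two-party reduction onto parties j and j+1 and ρ_{{0,n-1}} is the two-party reduction onto the first and last parties. -/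
open Matrix
open scoped ComplexOrder

open Module in
theorem pathAux_finrank_map₂_le {P D T : Type*} [AddCommGroup P] [Module ℂ P]
    [AddCommGroup D] [Module ℂ D] [AddCommGroup T] [Module ℂ T]
    [FiniteDimensional ℂ P] [FiniteDimensional ℂ D]
    (f : P →ₗ[ℂ] D →ₗ[ℂ] T) (U : Submodule ℂ P) (V : Submodule ℂ D) :
    finrank ℂ (Submodule.map₂ f U V) ≤ finrank ℂ U * finrank ℂ V := by
  rw [TensorProduct.map₂_eq_range_lift_comp_mapIncl, ← Module.finrank_tensorProduct (R := ℂ) (S := ℂ)]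
  exact LinearMap.finrank_range_le _

/-- If `q₀` has maximal rank along the line `q₀ + t q₁`, then `q₁` maps the kernel
of `q₀` into the range of `q₀`. -/
theorem pathAux_ker_le_range {D E : Type*} [AddCommGroup D] [Module ℂ D]
    [AddCommGroup E] [Module ℂ E] [FiniteDimensional ℂ D] [FiniteDimensional ℂ E]
    (q₀ q₁ : D →ₗ[ℂ] E)
    (hmax : ∀ t : ℂ, Module.finrank ℂ (LinearMap.range (q₀ + t • q₁)) ≤
      Module.finrank ℂ (LinearMap.range q₀))
    (x : D) (hx : q₀ x = 0) : q₁ x ∈ LinearMap.range q₀ := by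
  by_contra hnot
  set s := Module.finrank ℂ (LinearMap.range q₀) with hs
  let b := Module.finBasis ℂ (LinearMap.range q₀)
  choose v hv using fun i => (b i).2
  have hli : LinearIndependent ℂ (fun i => q₀ (v i)) := by
    have : (fun i => q₀ (v i)) = fun i => ((b i : LinearMap.range q₀) : E) := funext hv
    rw [this]
    exact b.linearIndependent.map' (Submodule.subtype _) (Submodule.ker_subtype _)
  have hspan : Submodule.span ℂ (Set.range fun i => q₀ (v i)) ≤ LinearMap.range q₀ := by
    rw [Submodule.span_le]
    rintro _ ⟨i, rfl⟩
    exact ⟨v i, rfl⟩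
  have hli' : LinearIndependent ℂ (Fin.cons (q₁ x) (fun i => q₀ (v i)) : Fin (_ + 1) → E) :=
    linearIndependent_finCons.2 ⟨hli, fun h => hnot (hspan h)⟩
  let e : E ≃ₗ[ℂ] (Fin (Module.finrank ℂ E) → ℂ) := (Module.finBasis ℂ E).equivFun
  let F : ℂ → Fin (s + 1) → (Fin (Module.finrank ℂ E) → ℂ) := fun t =>
    Fin.cons (e (q₁ x)) (fun i => e (q₀ (v i)) + t • e (q₁ (v i)))
  have hF : Continuous F := by
    refine continuous_pi fun i => ?_
    refine Fin.cases ?_ (fun i => ?_) i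
    · simp only [F, Fin.cons_zero]; exact continuous_const
    · simp only [F, Fin.cons_succ]; fun_prop
  have hF0 : LinearIndependent ℂ (F 0) := by
    have := hli'.map' e.toLinearMap (LinearEquiv.ker e)
    have h0 : F 0 = e.toLinearMap ∘
        (Fin.cons (q₁ x) (fun i => q₀ (v i)) : Fin (s + 1) → E) := by
      funext i
      refine Fin.cases ?_ (fun i => ?_) i <;> simp [F]
    rw [h0]
    exact this
  have hopen : IsOpen (F ⁻¹' {f | LinearIndependent ℂ f}) :=
    isOpen_setOfPred_linearIndependent.preimage hF
  have hnhds : F ⁻¹' {f | LinearIndependent ℂ f} ∈ nhds (0 : ℂ) := hopen.mem_nhds hF0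
  obtain ⟨t, ht, ht0⟩ : ∃ t, t ∈ F ⁻¹' {f | LinearIndependent ℂ f} ∧ t ≠ 0 := by
    have h1 : ∀ᶠ t in nhdsWithin (0 : ℂ) {0}ᶜ, t ∈ F ⁻¹' {f | LinearIndependent ℂ f} :=
      mem_nhdsWithin_of_mem_nhds hnhds
    have h2 : ∀ᶠ t in nhdsWithin (0 : ℂ) {0}ᶜ, t ∈ ({0}ᶜ : Set ℂ) := self_mem_nhdsWithin
    obtain ⟨t, h⟩ := (h1.and h2).exists
    exact ⟨t, h.1, h.2⟩
  have hG : LinearIndependent ℂ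
      (Fin.cons (q₁ x) (fun i => (q₀ + t • q₁) (v i)) : Fin (s + 1) → E) := by
    have : F t = e.toLinearMap ∘
        (Fin.cons (q₁ x) (fun i => (q₀ + t • q₁) (v i)) : Fin (s + 1) → E) := by
      funext i
      refine Fin.cases ?_ (fun i => ?_) i <;> simp [F]
    have ht' : LinearIndependent ℂ (F t) := ht
    rw [this] at ht'
    exact ht'.of_comp _
  have hle : Submodule.span ℂ (Set.range
      (Fin.cons (q₁ x) (fun i => (q₀ + t • q₁) (v i)) : Fin (s + 1) → E)) ≤
      LinearMap.range (q₀ + t • q₁) := by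
    rw [Submodule.span_le]
    rintro _ ⟨i, rfl⟩
    refine Fin.cases ?_ (fun i => ?_) i
    · refine ⟨t⁻¹ • x, ?_⟩
      simp [hx, ht0]
    · exact ⟨v i, by simp⟩
  have h1 := Submodule.finrank_mono hle
  rw [finrank_span_eq_card hG, Fintype.card_fin] at h1
  have h2 := hmax t
  omega

/-- The bilinear map `(a, b) ↦ p a ∘ q b`. -/
noncomputable def pathAuxTau {P Q D E C : Type*} [AddCommGroup P] [Module ℂ P]
    [AddCommGroup Q] [Module ℂ Q] [AddCommGroup D] [Module ℂ D]
    [AddCommGroup E] [Module ℂ E] [AddCommGroup C] [Module ℂ C]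
    (p : P →ₗ[ℂ] E →ₗ[ℂ] C) (q : Q →ₗ[ℂ] D →ₗ[ℂ] E) : P →ₗ[ℂ] Q →ₗ[ℂ] D →ₗ[ℂ] C :=
  (LinearMap.llcomp ℂ D E C ∘ₗ p).compl₂ q

@[simp] theorem pathAuxTau_apply {P Q D E C : Type*} [AddCommGroup P] [Module ℂ P]
    [AddCommGroup Q] [Module ℂ Q] [AddCommGroup D] [Module ℂ D]
    [AddCommGroup E] [Module ℂ E] [AddCommGroup C] [Module ℂ C]
    (p : P →ₗ[ℂ] E →ₗ[ℂ] C) (q : Q →ₗ[ℂ] D →ₗ[ℂ] E) (a : P) (b : Q) (x : D) :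
    pathAuxTau p q a b x = p a (q b x) := rfl

open Module in
theorem pathAux_core {Q : Type*} {C : Type*} [AddCommGroup Q] [Module ℂ Q] [AddCommGroup C]
    [Module ℂ C] [FiniteDimensional ℂ Q] [FiniteDimensional ℂ C] (N : ℕ) :
    ∀ {P : Type*} {D : Type*} {E : Type*} [AddCommGroup P] [Module ℂ P]
    [AddCommGroup D] [Module ℂ D] [AddCommGroup E] [Module ℂ E]
    [FiniteDimensional ℂ P] [FiniteDimensional ℂ D] [FiniteDimensional ℂ E]
    (p : P →ₗ[ℂ] E →ₗ[ℂ] C) (q : Q →ₗ[ℂ] D →ₗ[ℂ] E),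
    finrank ℂ D + finrank ℂ E = N →
    finrank ℂ (Submodule.map₂ (pathAuxTau p q.flip) ⊤ ⊤) ≤
      finrank ℂ E * finrank ℂ (Submodule.map₂ (pathAuxTau p q) ⊤ ⊤) := by
  induction N using Nat.strong_induction_on with
  | _ N ih =>
  intro P D E _ _ _ _ _ _ _ _ _ p q hN
  by_cases hq : q = 0
  · have : Submodule.map₂ (pathAuxTau p q.flip) ⊤ ⊤ = ⊥ := by
      rw [eq_bot_iff, Submodule.map₂_le]
      intro a _ x _
      rw [Submodule.mem_bot]
      ext b
      simp [hq]
    rw [this]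
    simp
  -- a member of maximal rank
  obtain ⟨b₀, hb₀⟩ : ∃ b₀ : Q, ∀ b : Q, finrank ℂ (LinearMap.range (q b)) ≤
      finrank ℂ (LinearMap.range (q b₀)) := by
    have hne : (Set.range fun b : Q => finrank ℂ (LinearMap.range (q b))).Nonempty :=
      ⟨_, 0, rfl⟩
    have hbd : BddAbove (Set.range fun b : Q => finrank ℂ (LinearMap.range (q b))) := by
      refine ⟨finrank ℂ E, ?_⟩
      rintro _ ⟨b, rfl⟩
      exact Submodule.finrank_le _
    obtain ⟨b₀, h⟩ := Nat.sSup_mem hne hbd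
    refine ⟨b₀, fun b => ?_⟩
    dsimp only at h
    rw [h]
    exact le_csSup hbd ⟨b, rfl⟩
  set E₀ := LinearMap.range (q b₀) with hE₀
  set D₀ := LinearMap.ker (q b₀) with hD₀
  have hDE : ∀ (b : Q) (x : D), x ∈ D₀ → q b x ∈ E₀ := by
    intro b x hx
    refine pathAux_ker_le_range (q b₀) (q b) (fun t => ?_) x hx
    have := hb₀ (b₀ + t • b)
    rwa [map_add, map_smul] at this
  have hrn : finrank ℂ E₀ + finrank ℂ D₀ = finrank ℂ D :=
    LinearMap.finrank_range_add_finrank_ker (q b₀)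
  have hpos : 0 < finrank ℂ E₀ := by
    obtain ⟨b, hb⟩ : ∃ b, q b ≠ 0 := by
      by_contra! h
      exact hq (LinearMap.ext h)
    refine lt_of_lt_of_le ?_ (hb₀ b)
    rw [Module.finrank_pos_iff, Submodule.nontrivial_iff_ne_bot, Ne, LinearMap.range_eq_bot]
    exact hb
  obtain ⟨E₁, hE⟩ := Submodule.exists_isCompl E₀
  obtain ⟨D₁, hD⟩ := Submodule.exists_isCompl D₀
  have hEdim : finrank ℂ E₀ + finrank ℂ E₁ = finrank ℂ E :=
    Submodule.finrank_add_eq_of_isCompl hE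
  have hDdim : finrank ℂ D₀ + finrank ℂ D₁ = finrank ℂ D :=
    Submodule.finrank_add_eq_of_isCompl hD
  -- those `a` with `p a` vanishing on `E₀`
  let κ : P →ₗ[ℂ] D →ₗ[ℂ] C := (pathAuxTau p q).flip b₀
  set P' := LinearMap.ker κ with hP'
  obtain ⟨P'', hP⟩ := Submodule.exists_isCompl P'
  have hPdim : finrank ℂ P' + finrank ℂ P'' = finrank ℂ P :=
    Submodule.finrank_add_eq_of_isCompl hP
  have hκ : finrank ℂ (LinearMap.range κ) + finrank ℂ P' = finrank ℂ P :=
    LinearMap.finrank_range_add_finrank_ker κ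
  have hkill : ∀ a ∈ P', ∀ y ∈ E₀, p a y = 0 := by
    rintro a ha _ ⟨x, rfl⟩
    exact LinearMap.congr_fun ha x
  set T := Submodule.map₂ (pathAuxTau p q) ⊤ ⊤ with hT
  -- first subsystem
  let p₀ : P →ₗ[ℂ] E₀ →ₗ[ℂ] C := p.compl₂ E₀.subtype
  let q₀ : Q →ₗ[ℂ] D₀ →ₗ[ℂ] E₀ := (q.compr₂ (E₀.projectionOnto E₁ hE)).compl₂ D₀.subtype
  have hpq₀ : ∀ a b (x : D₀), p₀ a (q₀ b x) = p a (q b x) := by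
    intro a b x
    simp only [p₀, q₀, LinearMap.compl₂_apply, LinearMap.compr₂_apply, Submodule.subtype_apply]
    rw [Submodule.projectionOnto_apply_of_mem_left hE (hDE b x x.2)]
  have ih₀ := ih (finrank ℂ D₀ + finrank ℂ E₀) (by omega) p₀ q₀ rfl
  -- second subsystem
  let p₁ : P' →ₗ[ℂ] E₁ →ₗ[ℂ] C := (p.compl₂ E₁.subtype) ∘ₗ P'.subtype
  let q₁ : Q →ₗ[ℂ] D₁ →ₗ[ℂ] E₁ := (q.compr₂ (E₁.projectionOnto E₀ hE.symm)).compl₂ D₁.subtype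
  have hpq₁ : ∀ (a : P') b (x : D₁), p₁ a (q₁ b x) = p a (q b x) := by
    intro a b x
    simp only [p₁, q₁, LinearMap.compl₂_apply, LinearMap.compr₂_apply, Submodule.subtype_apply,
      LinearMap.comp_apply]
    have h := Submodule.projection_add_projection_eq_self hE (q b x)
    conv_rhs => rw [← h]
    rw [map_add, hkill a a.2 _ (Submodule.projection_apply_mem hE _), zero_add]
    rfl
  have ih₁ := ih (finrank ℂ D₁ + finrank ℂ E₁) (by omega) p₁ q₁ rfl
  set T₀ := Submodule.map₂ (pathAuxTau p₀ q₀) ⊤ ⊤ with hT₀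
  set T₁ := Submodule.map₂ (pathAuxTau p₁ q₁) ⊤ ⊤ with hT₁
  set S₀ := Submodule.map₂ (pathAuxTau p₀ q₀.flip) ⊤ ⊤ with hS₀
  set S₁ := Submodule.map₂ (pathAuxTau p₁ q₁.flip) ⊤ ⊤ with hS₁
  -- dimension of `T₁`
  have hT₁T : finrank ℂ T₁ ≤ finrank ℂ T := by
    have hle : T₁ ≤ T.map (LinearMap.lcomp ℂ C D₁.subtype) := by
      rw [hT₁, Submodule.map₂_le]
      intro a _ b _
      refine ⟨pathAuxTau p q a b, Submodule.apply_mem_map₂ _ trivial trivial, ?_⟩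
      ext x
      exact (hpq₁ a b x).symm
    exact (Submodule.finrank_mono hle).trans (Submodule.finrank_map_le _ _)
  -- dimension of `T₀`
  have hT₀T : finrank ℂ T₀ + finrank ℂ P'' ≤ finrank ℂ T := by
    let res : (D →ₗ[ℂ] C) →ₗ[ℂ] (D₀ →ₗ[ℂ] C) := LinearMap.lcomp ℂ C D₀.subtype
    have hle : T₀ ≤ LinearMap.range (res ∘ₗ T.subtype) := by
      rw [hT₀, Submodule.map₂_le]
      intro a _ b _
      refine ⟨⟨pathAuxTau p q a b, Submodule.apply_mem_map₂ _ trivial trivial⟩, ?_⟩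
      ext x
      exact (hpq₀ a b x).symm
    have hle2 : LinearMap.range κ ≤ (LinearMap.ker (res ∘ₗ T.subtype)).map T.subtype := by
      rintro _ ⟨a, rfl⟩
      refine ⟨⟨pathAuxTau p q a b₀, Submodule.apply_mem_map₂ _ trivial trivial⟩, ?_, rfl⟩
      change res (pathAuxTau p q a b₀) = 0
      ext x
      have : q b₀ x = 0 := x.2
      simp [res, this]
    have h1 := Submodule.finrank_mono hle
    have h2 := (Submodule.finrank_mono hle2).trans (Submodule.finrank_map_le _ _)
    have h3 := LinearMap.finrank_range_add_finrank_ker (res ∘ₗ T.subtype)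
    omega
  -- splitting of the target
  set M₂ := Submodule.map₂ (pathAuxTau p q.flip) P'' D₁ with hM₂
  have hM₂dim : finrank ℂ M₂ ≤ finrank ℂ P'' * finrank ℂ D₁ := pathAux_finrank_map₂_le _ _ _
  have hle : Submodule.map₂ (pathAuxTau p q.flip) ⊤ ⊤ ≤ (S₀ ⊔ S₁) ⊔ M₂ := by
    have e0 : Submodule.map₂ (pathAuxTau p q.flip) ⊤ D₀ ≤ S₀ := by
      rw [Submodule.map₂_le]
      intro a _ x hx
      have : pathAuxTau p q.flip a x = pathAuxTau p₀ q₀.flip a ⟨x, hx⟩ := by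
        ext b
        exact (hpq₀ a b ⟨x, hx⟩).symm
      rw [this]
      exact Submodule.apply_mem_map₂ _ trivial trivial
    have e1 : Submodule.map₂ (pathAuxTau p q.flip) P' D₁ ≤ S₁ := by
      rw [Submodule.map₂_le]
      intro a ha x hx
      have : pathAuxTau p q.flip a x = pathAuxTau p₁ q₁.flip ⟨a, ha⟩ ⟨x, hx⟩ := by
        ext b
        exact (hpq₁ ⟨a, ha⟩ b ⟨x, hx⟩).symm
      rw [this]
      exact Submodule.apply_mem_map₂ _ trivial trivial
    rw [← hD.sup_eq_top, Submodule.map₂_sup_right]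
    refine sup_le (e0.trans (le_sup_left.trans le_sup_left)) ?_
    rw [← hP.sup_eq_top, Submodule.map₂_sup_left]
    exact sup_le (e1.trans (le_sup_right.trans le_sup_left)) le_sup_right
  have f1 := Submodule.finrank_mono hle
  have f2 := Submodule.finrank_add_le_finrank_add_finrank (S₀ ⊔ S₁) M₂
  have f3 := Submodule.finrank_add_le_finrank_add_finrank S₀ S₁
  have hD₁ : finrank ℂ D₁ = finrank ℂ E₀ := by omega
  rw [hD₁] at hM₂dim
  have g1 : finrank ℂ E₁ * finrank ℂ T₁ ≤ finrank ℂ E₁ * finrank ℂ T :=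
    Nat.mul_le_mul_left _ hT₁T
  have g2 : finrank ℂ E₀ * (finrank ℂ T₀ + finrank ℂ P'') ≤ finrank ℂ E₀ * finrank ℂ T :=
    Nat.mul_le_mul_left _ hT₀T
  rw [← hEdim]
  nlinarith

/-- The partial transpose rank inequality. -/
theorem pathAux_rank4 {α β γ δ : Type*} [Fintype α] [Fintype β] [Fintype γ] [Fintype δ]
    (ψ : α → β → γ → δ → ℂ) :
    (Matrix.of fun (r : β × γ) (s : α × δ) => ψ s.1 r.1 r.2 s.2).rank ≤
      (Matrix.of fun (r : β × α) (s : γ × δ) => ψ r.2 r.1 s.1 s.2).rank *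
      (Matrix.of fun (r : α × γ) (s : β × δ) => ψ r.1 s.1 r.2 s.2).rank := by
  classical
  set M := (Matrix.of fun (r : α × γ) (s : β × δ) => ψ r.1 s.1 r.2 s.2) with hM
  set K := (Matrix.of fun (r : β × α) (s : γ × δ) => ψ r.2 r.1 s.1 s.2) with hK
  let E := LinearMap.range M.mulVecLin
  let p : (α → ℂ) →ₗ[ℂ] E →ₗ[ℂ] (γ → ℂ) :=
    LinearMap.mk₂ ℂ (fun u e c => ∑ a, u a * (e : α × γ → ℂ) (a, c))
      (by intros; ext; simp [add_mul, Finset.sum_add_distrib])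
      (by intros; ext; simp [mul_assoc, Finset.mul_sum])
      (by intros; ext; simp [mul_add, Finset.sum_add_distrib])
      (by intros; ext; simp [mul_left_comm, Finset.mul_sum])
  let q : (β → ℂ) →ₗ[ℂ] (δ → ℂ) →ₗ[ℂ] E :=
    LinearMap.mk₂ ℂ (fun v w => M.mulVecLin.rangeRestrict (fun s => v s.1 * w s.2))
      (by intros; rw [← map_add]; congr 1; ext; simp [add_mul])
      (by intros; rw [← map_smul]; congr 1; ext; simp [mul_assoc])
      (by intros; rw [← map_add]; congr 1; ext; simp [mul_add])
      (by intros; rw [← map_smul]; congr 1; ext; simp [mul_left_comm])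
  have hpq : ∀ u v w c, p u (q v w) c =
      ∑ a, u a * ∑ s : β × δ, ψ a s.1 c s.2 * (v s.1 * w s.2) := by
    intro u v w c
    rfl
  have core := pathAux_core _ p q rfl
  have hEr : Module.finrank ℂ E = M.rank := rfl
  rw [hEr, mul_comm] at core
  refine le_trans ?_ (core.trans (Nat.mul_le_mul_right _ ?_))
  · -- the target rank
    let Λ : ((β → ℂ) →ₗ[ℂ] (γ → ℂ)) →ₗ[ℂ] (β × γ → ℂ) :=
      { toFun := fun h r => h (Pi.single r.1 1) r.2
        map_add' := by intros; rfl
        map_smul' := by intros; rfl }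
    rw [Matrix.rank_eq_finrank_span_cols]
    refine le_trans (Submodule.finrank_mono ?_) (Submodule.finrank_map_le Λ _)
    rw [Submodule.span_le]
    rintro _ ⟨s, rfl⟩
    refine ⟨pathAuxTau p q.flip (Pi.single s.1 1) (Pi.single s.2 1),
      Submodule.apply_mem_map₂ _ trivial trivial, ?_⟩
    funext r
    change p (Pi.single s.1 1) (q (Pi.single r.1 1) (Pi.single s.2 1)) r.2 = _
    rw [hpq]
    simp [Fintype.sum_prod_type, Pi.single_apply, Matrix.col]
  · let Λ : (γ × δ → ℂ) →ₗ[ℂ] ((δ → ℂ) →ₗ[ℂ] (γ → ℂ)) :=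
      LinearMap.mk₂ ℂ (fun h w c => ∑ d, h (c, d) * w d)
      (by intros; ext; simp [add_mul, Finset.sum_add_distrib])
      (by intros; ext; simp [mul_assoc, Finset.mul_sum])
      (by intros; ext; simp [mul_add, Finset.sum_add_distrib])
      (by intros; ext; simp [mul_left_comm, Finset.mul_sum])
    rw [Matrix.rank_eq_finrank_span_row]
    refine le_trans (Submodule.finrank_mono ?_) (Submodule.finrank_map_le Λ _)
    rw [Submodule.map₂_le]
    intro u _ v _
    refine ⟨∑ r : β × α, (v r.1 * u r.2) • K.row r, ?_, ?_⟩
    · exact Submodule.sum_mem _ fun r _ => Submodule.smul_mem _ _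
        (Submodule.subset_span ⟨r, rfl⟩)
    · refine LinearMap.ext fun w => funext fun c => ?_
      rw [pathAuxTau_apply, hpq]
      change ∑ d, (∑ r : β × α, (v r.1 * u r.2) • K.row r) (c, d) * w d = _
      simp only [Finset.sum_apply, Pi.smul_apply, smul_eq_mul, Finset.sum_mul, Finset.mul_sum,
        Fintype.sum_prod_type, Matrix.row, hK, Matrix.of_apply]
      rw [Finset.sum_congr rfl fun d _ => Finset.sum_comm, Finset.sum_comm]
      refine Finset.sum_congr rfl fun a _ => ?_
      rw [Finset.sum_comm]
      refine Finset.sum_congr rfl fun b _ => Finset.sum_congr rfl fun d _ => ?_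
      ring

/-- The rank of a two-party reduction as the rank of a flattening of a purification. -/
theorem pathAux_rank_reduce {n : ℕ} {A : Fin n → Type*}
    [∀ i, Fintype (A i)] [∀ i, DecidableEq (A i)] (X : Matrix (∀ i, A i) (∀ i, A i) ℂ)
    (f₀ : ∀ i, A i) (i k j : Fin n) (hik : i ≠ k) (hij : i ≠ j) (hjk : j ≠ k)
    (u : A i → A k → A j → (∀ l, A l) → ∀ l, A l)
    (hui : ∀ a c b f, u a c b f i = a) (huk : ∀ a c b f, u a c b f k = c)
    (huj : ∀ a c b f, u a c b f j = b)
    (hu : ∀ a c b f l, l ≠ i → l ≠ k → l ≠ j → u a c b f l = f l) :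
    (reduceMat (X * Xᴴ) {i, k}).rank =
      (Matrix.of fun (r : A i × A k) (s : A j × ((∀ l, A l) × (∀ l, A l))) =>
        X (u r.1 r.2 s.1 s.2.1) s.2.2).rank := by
  classical
  set S : Finset (Fin n) := {i, k} with hS
  have hiS : i ∈ S := by simp [hS]
  have hkS : k ∈ S := by simp [hS]
  have hjS : j ∉ S := by simp [hS, hij.symm, hjk]
  let Y : Matrix (∀ i : {i // i ∈ S}, A i.val)
      ((∀ i : {i // i ∉ S}, A i.val) × (∀ l, A l)) ℂ :=
    Matrix.of fun x s => X (glue S x s.1) s.2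
  have hY : reduceMat (X * Xᴴ) S = Y * Yᴴ := by
    ext x y
    simp [reduceMat, Y, Matrix.mul_apply, Fintype.sum_prod_type]
  rw [hY, Matrix.rank_self_mul_conjTranspose]
  apply le_antisymm
  · have : Y = (Matrix.of fun (r : A i × A k) (s : A j × ((∀ l, A l) × (∀ l, A l))) =>
        X (u r.1 r.2 s.1 s.2.1) s.2.2).submatrix (fun x => (x ⟨i, hiS⟩, x ⟨k, hkS⟩))
        (fun s => (s.1 ⟨j, hjS⟩, (glue S (fun l => f₀ l) s.1, s.2))) := by
      ext x s
      simp only [Y, Matrix.of_apply, Matrix.submatrix_apply]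
      congr 1
      funext l
      by_cases h1 : l = i
      · subst h1; rw [hui]; simp [glue, hiS]
      by_cases h2 : l = k
      · subst h2; rw [huk]; simp [glue, hkS]
      by_cases h3 : l = j
      · subst h3; rw [huj]; simp [glue, hjS]
      have h4 : l ∉ S := by simp [hS, h1, h2]
      rw [hu _ _ _ _ _ h1 h2 h3]
      simp [glue, h4]
    rw [this]
    exact Matrix.rank_submatrix_le _ _ _
  · have : (Matrix.of fun (r : A i × A k) (s : A j × ((∀ l, A l) × (∀ l, A l))) =>
        X (u r.1 r.2 s.1 s.2.1) s.2.2) = Y.submatrix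
        (fun r l => u r.1 r.2 (f₀ j) f₀ l) (fun s => (fun l => u (f₀ i) (f₀ k) s.1 s.2.1 l, s.2.2)) := by
      ext r s
      simp only [Y, Matrix.of_apply, Matrix.submatrix_apply]
      congr 1
      funext l
      by_cases h1 : l = i
      · subst h1; simp [glue, hiS, hui]
      by_cases h2 : l = k
      · subst h2; simp [glue, hkS, huk]
      by_cases h3 : l = j
      · subst h3; simp [glue, hjS, huj]
      have h4 : l ∉ S := by simp [hS, h1, h2]
      simp [glue, h4, hu _ _ _ _ _ h1 h2 h3]
    rw [this]
    exact Matrix.rank_submatrix_le _ _ _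

/-- The triangle inequality for ranks of two-party reductions. -/
theorem pathAux_triangle {n : ℕ} {A : Fin n → Type*}
    [∀ i, Fintype (A i)] [∀ i, DecidableEq (A i)]
    (ρ : Matrix (∀ i, A i) (∀ i, A i) ℂ) (hρ : ρ.PosSemidef)
    (i j k : Fin n) (hij : i ≠ j) (hik : i ≠ k) (hjk : j ≠ k) :
    (reduceMat ρ {i, k}).rank ≤ (reduceMat ρ {i, j}).rank * (reduceMat ρ {j, k}).rank := by
  classical
  rcases isEmpty_or_nonempty (∀ l, A l) with hemp | ⟨⟨f₀⟩⟩
  · have : reduceMat ρ {i, k} = 0 := by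
      ext x y
      simp only [reduceMat, Matrix.of_apply, Matrix.zero_apply]
      exact Finset.sum_eq_zero fun z _ => hemp.elim (glue _ x z)
    rw [this, Matrix.rank_zero]
    exact Nat.zero_le _
  obtain ⟨B, rfl⟩ : ∃ X : Matrix (∀ i, A i) (∀ i, A i) ℂ, ρ = X * Xᴴ := by
    open scoped MatrixOrder Matrix.Norms.L2Operator in
    exact CStarAlgebra.nonneg_iff_eq_mul_star_self.mp hρ.nonneg
  let U : A j → A i → A k → (∀ l, A l) → ∀ l, A l := fun b a c f =>
    Function.update (Function.update (Function.update f i a) k c) j b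
  have hUi : ∀ b a c f, U b a c f i = a := by
    intros; simp [U, hij, hik]
  have hUk : ∀ b a c f, U b a c f k = c := by
    intros; simp [U, hjk.symm]
  have hUj : ∀ b a c f, U b a c f j = b := by
    intros; simp [U]
  have hU : ∀ b a c f l, l ≠ i → l ≠ k → l ≠ j → U b a c f l = f l := by
    intro b a c f l h1 h2 h3; simp [U, h1, h2, h3]
  have key := pathAux_rank4 (fun (b : A j) (a : A i) (c : A k)
    (s : (∀ l, A l) × (∀ l, A l)) => B (U b a c s.1) s.2)
  rw [pathAux_rank_reduce B f₀ i k j hik hij hjk (fun a c b f => U b a c f)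
      (fun _ _ _ _ => hUi _ _ _ _) (fun _ _ _ _ => hUk _ _ _ _) (fun _ _ _ _ => hUj _ _ _ _)
      (fun _ _ _ _ _ h1 h2 h3 => hU _ _ _ _ _ h1 h2 h3),
    pathAux_rank_reduce B f₀ i j k hij hik hjk.symm (fun a b c f => U b a c f)
      (fun _ _ _ _ => hUi _ _ _ _) (fun _ _ _ _ => hUj _ _ _ _) (fun _ _ _ _ => hUk _ _ _ _)
      (fun _ _ _ _ _ h1 h2 h3 => hU _ _ _ _ _ h1 h3 h2),
    pathAux_rank_reduce B f₀ j k i hjk hij.symm hik (fun b c a f => U b a c f)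
      (fun _ _ _ _ => hUj _ _ _ _) (fun _ _ _ _ => hUk _ _ _ _) (fun _ _ _ _ => hUi _ _ _ _)
      (fun _ _ _ _ _ h1 h2 h3 => hU _ _ _ _ _ h3 h2 h1)]
  exact key

/-- Path inequality: for a positive semidefinite `n`-partite matrix (`n ≥ 2`), the
product of the ranks of the consecutive two-party reductions `ρ_{j,j+1}`,
`j = 0, …, n-2`, is at least the rank of the two-party reduction onto the first and
last parties. -/
theorem prod_rank_path_pairs_ge_rank_ends
    {n : ℕ} (hn : 2 ≤ n) {A : Fin n → Type*}
    [∀ i, Fintype (A i)] [∀ i, DecidableEq (A i)]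
    (ρ : Matrix (∀ i, A i) (∀ i, A i) ℂ) (hρ : ρ.PosSemidef) :
    ∏ j : Fin (n - 1),
        (reduceMat ρ {⟨j.val, Nat.lt_of_lt_of_le j.isLt (Nat.sub_le n 1)⟩,
          ⟨j.val + 1, by have := j.isLt; omega⟩}).rank ≥
      (reduceMat ρ {⟨0, by omega⟩, ⟨n - 1, by omega⟩}).rank := by
  have main : ∀ m : ℕ, ∀ hm : m + 1 < n,
      (reduceMat ρ {⟨0, by omega⟩, ⟨m + 1, hm⟩}).rank ≤
      ∏ j : Fin (m + 1), (reduceMat ρ {⟨j.val, by have := j.isLt; omega⟩,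
          ⟨j.val + 1, by have := j.isLt; omega⟩}).rank := by
    intro m
    induction m with
    | zero =>
      intro hm
      simp
    | succ m ih =>
      intro hm
      rw [Fin.prod_univ_castSucc]
      refine (pathAux_triangle ρ hρ ⟨0, by omega⟩ ⟨m + 1, by omega⟩ ⟨m + 1 + 1, hm⟩
        (by simp) (by simp) (by simp)).trans ?_
      exact Nat.mul_le_mul_right _ (ih (by omega))
  obtain ⟨m, rfl⟩ : ∃ m, n = m + 2 := ⟨n - 2, by omega⟩
  exact main m (by omega)
end
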